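/- arXiv:2604.01946 — 4 statements merged into one kernel-verified Lean document; each statement's English description precedes it below -/
import Mathlib

section
/- Let ℓ : Θ × 𝒵 → [0,1] be a measurable loss, let Z_1, …, Z_n be i.i.d. 𝒵-valued random variables, and define L(θ) := E[ℓ(θ; Z_1)], L̂_n(θ) := n^{−1} Σ_{i=1}^n ℓ(θ; Z_i), and for Q ≪ Π0 the aggregates L(Q) := E_{θ∼Q}[L(θ)] and L̂_n(Q) := E_{θ∼Q}[L̂_n(θ)]. Then for every δ ∈ (0,1), with probability at least 1 − δ, the inequality L(Q) ≤ ( 1 − exp( −c_{n,δ}(Q) − γ·L̂_n(Q) ) ) / ( 1 − exp(−γ) ) holds simultaneously for all posteriors Q ≪ Π0 and all γ > 0, where c_{n,δ}(Q) := ( KL(Q‖Π0) + log(ξ(n)/δ) ) / n and ξ(n) := exp(1/(12n)) · √(πn/2) + 2. -/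
open MeasureTheory ProbabilityTheory Real
open scoped ENNReal

/-- `KL(Q‖Π0) = ∫ log(dQ/dΠ0) dQ` (as a real number, for `Q ≪ Π0` with integrable llr) -/
noncomputable def KLreal {Θ : Type*} [MeasurableSpace Θ] (Q Pri : Measure Θ) : ℝ :=
  ∫ θ, llr Q Pri θ ∂Q

/-- Upper half of Stirling's formula with explicit error term. -/
theorem factorial_le_stirling_mul_exp {n : ℕ} (hn : n ≠ 0) :
    (n.factorial : ℝ) ≤ √(2 * π * n) * (n / exp 1) ^ n * exp (1 / (12 * n)) := by
  obtain ⟨m, rfl⟩ := Nat.exists_eq_succ_of_ne_zero hn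
  have hmono : Monotone fun k : ℕ =>
      log (Stirling.stirlingSeq (k + 1)) - 1 / (12 * ((k + 1 : ℕ) : ℝ)) := by
    refine monotone_nat_of_le_succ fun k => ?_
    have h := Stirling.log_stirlingSeq_sdiff_le (k + 1)
    have h2 : (1 : ℝ) / (12 * ((k + 1 : ℕ) : ℝ) * (((k + 1 : ℕ) : ℝ) + 1))
        = 1 / (12 * ((k + 1 : ℕ) : ℝ)) - 1 / (12 * ((k + 1 + 1 : ℕ) : ℝ)) := by
      push_cast
      field_simp
      ring
    linarith
  have hlim : Filter.Tendsto (fun k : ℕ =>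
      log (Stirling.stirlingSeq (k + 1)) - 1 / (12 * ((k + 1 : ℕ) : ℝ))) Filter.atTop
      (nhds (log √π - 0)) := by
    have h1 := (Stirling.tendsto_stirlingSeq_sqrt_pi.log (by positivity)).comp
      (Filter.tendsto_add_atTop_nat 1)
    have h2 : Filter.Tendsto (fun k : ℕ => (1 : ℝ) / (12 * (k : ℝ))) Filter.atTop (nhds 0) := by
      have := tendsto_one_div_atTop_nhds_zero_nat (𝕜 := ℝ)
      simpa [mul_comm] using this.mul_const (12⁻¹ : ℝ)
    exact h1.sub (h2.comp (Filter.tendsto_add_atTop_nat 1))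
  have hle := hmono.ge_of_tendsto hlim m
  have hs : Stirling.stirlingSeq (m + 1) ≤ √π * exp (1 / (12 * ((m + 1 : ℕ) : ℝ))) := by
    rw [← log_le_log_iff (Stirling.stirlingSeq'_pos m) (by positivity),
      log_mul (by positivity) (exp_ne_zero _), log_exp]
    linarith
  rw [Stirling.stirlingSeq, div_le_iff₀ (by positivity)] at hs
  refine hs.trans_eq ?_
  have : √(2 * π * ((m + 1 : ℕ) : ℝ)) = √π * √(2 * ((m + 1 : ℕ) : ℝ)) := by
    rw [← sqrt_mul pi_nonneg]
    ring_nf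
  rw [Nat.succ_eq_add_one, this]
  ring

theorem choose_mul_pow_mul_pow_le {k m : ℕ} (hk : 0 < k) (hm : 0 < m) :
    ((k + m).choose k : ℝ) * ((k / (k + m : ℝ)) ^ k * (m / (k + m : ℝ)) ^ m)
      ≤ exp (1 / (12 * (k + m : ℝ))) * √((k + m) / (2 * π)) * (1 / √(k * m)) := by
  have hk' : (0 : ℝ) < k := by exact_mod_cast hk
  have hm' : (0 : ℝ) < m := by exact_mod_cast hm
  have h1 := Stirling.le_factorial_stirling k
  have h2 := Stirling.le_factorial_stirling m
  have h3 := factorial_le_stirling_mul_exp (n := k + m) (by omega)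
  have h4 : ((k + m).choose k : ℝ) * k.factorial * m.factorial = (k + m).factorial := by
    rw [Nat.choose_symm_add]
    exact_mod_cast Nat.add_choose_mul_factorial_mul_factorial k m
  have h5 : ((k + m).choose k : ℝ) * ((√(2 * π * k) * (k / exp 1) ^ k)
      * (√(2 * π * m) * (m / exp 1) ^ m)) ≤ (k + m).factorial := by
    rw [← h4, mul_assoc (_ : ℝ) (k.factorial : ℝ)]
    exact mul_le_mul_of_nonneg_left (mul_le_mul h1 h2 (by positivity) (by positivity))
      (by positivity)
  have h6 := h5.trans h3
  push_cast at h6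
  have e1 : (k / exp 1) ^ k * (m / exp 1) ^ m
      = ((k / (k + m : ℝ)) ^ k * (m / (k + m : ℝ)) ^ m) * ((k + m) / exp 1) ^ (k + m) := by
    rw [pow_add]
    simp only [div_pow]
    field_simp
  have e2 : √(2 * π * k) * √(2 * π * m) = (2 * π) * √(k * m) := by
    rw [← sqrt_mul (by positivity), show 2 * π * k * (2 * π * m) = (2 * π) ^ 2 * (k * m) by ring,
      sqrt_mul (by positivity), sqrt_sq (by positivity)]
  have e3 : √(2 * π * (k + m)) = (2 * π) * √((k + m) / (2 * π)) := by
    rw [show 2 * π * ((k : ℝ) + m) = (2 * π) ^ 2 * ((k + m) / (2 * π)) by field_simp,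
      sqrt_mul (by positivity), sqrt_sq (by positivity)]
  rw [mul_one_div, le_div_iff₀ (by positivity)]
  have hP : 0 < (2 * π) * ((k + m) / exp 1) ^ (k + m) := by positivity
  refine le_of_mul_le_mul_right ?_ hP
  calc _ = ((k + m).choose k : ℝ) * ((√(2 * π * k) * √(2 * π * m))
        * ((k / exp 1) ^ k * (m / exp 1) ^ m)) := by rw [e1, e2]; ring
    _ = ((k + m).choose k : ℝ) * ((√(2 * π * k) * (k / exp 1) ^ k)
      * (√(2 * π * m) * (m / exp 1) ^ m)) := by ring
    _ ≤ _ := h6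
    _ = _ := by rw [e3]; ring

theorem one_div_sqrt_le_arcsin_sub {n a c : ℝ} (hn : 0 < n) (ha : 0 ≤ a) (hb : a + 1 ≤ n)
    (hx : ∀ x ∈ Set.Ioo a (a + 1), x * (n - x) ≤ c * (n - c)) :
    1 / √(c * (n - c)) ≤ arcsin (2 * (a + 1) / n - 1) - arcsin (2 * a / n - 1) := by
  have hder : ∀ x ∈ Set.Ioo a (a + 1),
      HasDerivAt (fun x => arcsin (2 * x / n - 1)) (1 / √(x * (n - x))) x := by
    intro x hx
    have hx0 : 0 < x := ha.trans_lt hx.1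
    have hxn : x < n := hx.2.trans_le hb
    have hlt : 2 * x / n < 2 := by rw [div_lt_iff₀ hn]; linarith
    have hpos : 0 < 2 * x / n := by positivity
    have h1 : HasDerivAt (fun x : ℝ => 2 * x / n - 1) (2 * 1 / n) x :=
      (((hasDerivAt_id x).const_mul 2).div_const n).sub_const 1
    have h2 := (hasDerivAt_arcsin (x := 2 * x / n - 1) (by linarith) (by linarith)).comp x h1
    refine h2.congr_deriv ?_
    have hs : √(1 - (2 * x / n - 1) ^ 2) = 2 / n * √(x * (n - x)) := by
      rw [show 1 - (2 * x / n - 1) ^ 2 = (2 / n) ^ 2 * (x * (n - x)) by field_simp; ring,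
        sqrt_mul (by positivity), sqrt_sq (by positivity)]
    have : 0 < √(x * (n - x)) := sqrt_pos.2 (mul_pos hx0 (by linarith))
    rw [hs]
    field_simp
  obtain ⟨y, hy, hslope⟩ := exists_hasDerivAt_eq_slope (fun x => arcsin (2 * x / n - 1)) _
    (lt_add_one a) (by fun_prop) hder
  rw [add_sub_cancel_left, div_one] at hslope
  rw [← hslope]
  have hy0 : 0 < y * (n - y) := mul_pos (ha.trans_lt hy.1) (by linarith [hy.2])
  exact one_div_le_one_div_of_le (sqrt_pos.2 hy0) (sqrt_le_sqrt (hx y hy))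

theorem sum_one_div_sqrt_le_pi {n : ℕ} (hn : 0 < n) :
    ∑ k ∈ Finset.Ico 1 n, 1 / √((k : ℝ) * (n - k)) ≤ π := by
  have hn' : (0 : ℝ) < n := by exact_mod_cast hn
  set A : ℝ → ℝ := fun x => arcsin (2 * x / n - 1)
  have hmono : Monotone A := fun x y h => monotone_arcsin (by gcongr)
  set a : ℕ → ℝ := fun k => if 2 * k ≤ n then A (k - 1) else A k with haa
  have hstep : ∀ k ∈ Finset.Ico 1 n, 1 / √((k : ℝ) * (n - k)) ≤ a (k + 1) - a k := by
    intro k hk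
    rw [Finset.mem_Ico] at hk
    have hk1 : (1 : ℝ) ≤ k := by exact_mod_cast hk.1
    have hkn : (k : ℝ) + 1 ≤ n := by exact_mod_cast hk.2
    by_cases h : 2 * k ≤ n
    · have h' : 2 * (k : ℝ) ≤ n := by exact_mod_cast h
      have hle : A k ≤ a (k + 1) := by
        simp only [haa]
        split_ifs
        · simp
        · exact hmono (by push_cast; linarith)
      have := one_div_sqrt_le_arcsin_sub (n := n) (a := k - 1) (c := k) hn' (by linarith)
        (by linarith) (fun x hx => by nlinarith [hx.1, hx.2])
      rw [sub_add_cancel] at this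
      have hak : a k = A (k - 1) := if_pos h
      rw [hak]
      exact this.trans (sub_le_sub_right hle _)
    · have h' : (n : ℝ) < 2 * k := by exact_mod_cast not_le.1 h
      have hak : a k = A k := if_neg h
      have hak' : a (k + 1) = A (k + 1) := by
        simp only [haa]
        rw [if_neg (by omega)]
        push_cast
        rfl
      rw [hak, hak']
      exact one_div_sqrt_le_arcsin_sub hn' (by linarith) hkn
        (fun x hx => by nlinarith [hx.1, hx.2])
  refine (Finset.sum_le_sum hstep).trans ?_
  rw [Finset.sum_Ico_sub a hn]
  have hb : ∀ k, -(π / 2) ≤ a k ∧ a k ≤ π / 2 := by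
    intro k
    simp only [haa]
    split_ifs <;> exact ⟨neg_pi_div_two_le_arcsin _, arcsin_le_pi_div_two _⟩
  linarith [(hb n).2, (hb 1).1]

/-- Maurer's bound on the sum of maximal binomial likelihoods. -/
theorem sum_choose_mul_pow_le {n : ℕ} (hn : 0 < n) :
    ∑ k ∈ Finset.range (n + 1), (n.choose k : ℝ) * ((k / n : ℝ) ^ k * (1 - k / n : ℝ) ^ (n - k))
      ≤ exp (1 / (12 * n)) * √(π * n / 2) + 2 := by
  have hn' : (0 : ℝ) < n := by exact_mod_cast hn
  rw [Finset.sum_range_succ, Finset.range_eq_Ico, Finset.sum_eq_sum_Ico_succ_bot hn]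
  have hterm : ∀ k ∈ Finset.Ico 1 n,
      (n.choose k : ℝ) * ((k / n : ℝ) ^ k * (1 - k / n : ℝ) ^ (n - k))
        ≤ exp (1 / (12 * n)) * √(n / (2 * π)) * (1 / √((k : ℝ) * (n - k))) := by
    intro k hk
    rw [Finset.mem_Ico] at hk
    obtain ⟨m, rfl⟩ := Nat.exists_eq_add_of_le hk.2.le
    have h := choose_mul_pow_mul_pow_le (k := k) (m := m) (by omega) (by omega)
    have e : (1 : ℝ) - k / ((k + m : ℕ) : ℝ) = m / (k + m) := by
      push_cast at hn' ⊢
      field_simp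
      ring
    rw [e, Nat.add_sub_cancel_left]
    push_cast
    rwa [add_sub_cancel_left]
  have hsum := Finset.sum_le_sum hterm
  rw [← Finset.mul_sum] at hsum
  have hconst : √(n / (2 * π)) * π = √(π * n / 2) := by
    nth_rewrite 2 [← sqrt_sq pi_nonneg]
    rw [← sqrt_mul (by positivity)]
    congr 1
    field_simp
  have hle : exp (1 / (12 * n)) * √(n / (2 * π)) * ∑ k ∈ Finset.Ico 1 n, 1 / √((k : ℝ) * (n - k))
      ≤ exp (1 / (12 * n)) * √(n / (2 * π)) * π := by
    gcongr
    exact sum_one_div_sqrt_le_pi hn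
  rw [mul_assoc, mul_assoc, hconst, ← mul_assoc] at hle
  have h0 : (n.choose 0 : ℝ) * (((0 : ℕ) / n : ℝ) ^ 0 * (1 - (0 : ℕ) / n : ℝ) ^ (n - 0)) = 1 := by
    simp
  have h1 : (n.choose n : ℝ) * ((n / n : ℝ) ^ n * (1 - n / n : ℝ) ^ (n - n)) = 1 := by
    simp [hn'.ne']
  rw [h0, h1]
  simp only [zero_add]
  linarith

/-- The relative entropy of a Bernoulli distribution with parameter `q` with respect to one with
parameter `p`, for `p` in the open unit interval. -/
noncomputable def bernoulliKL (q p : ℝ) : ℝ :=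
  -binEntropy q - q * log p - (1 - q) * log (1 - p)

theorem convexOn_exp_mul_bernoulliKL (n : ℕ) (p : ℝ) :
    ConvexOn ℝ (Set.Icc 0 1) fun q => exp (n * bernoulliKL q p) := by
  have h1 : ConvexOn ℝ (Set.Icc 0 1) fun q => n * bernoulliKL q p := by
    have h2 : ConvexOn ℝ (Set.Icc (0 : ℝ) 1) fun q => -binEntropy q :=
      strictConcave_binEntropy.concaveOn.neg
    have h3 : ConvexOn ℝ (Set.Icc (0 : ℝ) 1)
        fun q => q * (log (1 - p) - log p) + -log (1 - p) := by
      refine ⟨convex_Icc 0 1, fun x _ y _ a b _ _ hab => le_of_eq ?_⟩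
      simp only [smul_eq_mul]
      obtain rfl : b = 1 - a := by linarith
      ring
    have h4 := (h2.add h3).smul (c := (n : ℝ)) (by positivity)
    refine h4.congr fun q _ => ?_
    simp only [bernoulliKL, Pi.add_apply, smul_eq_mul]
    ring
  exact ⟨convex_Icc 0 1, fun x hx y hy a b ha hb hab => (exp_le_exp.2 (h1.2 hx hy ha hb hab)).trans
    (convexOn_exp.2 trivial trivial ha hb hab)⟩

theorem mul_log_div_le {q a : ℝ} (hq : 0 ≤ q) (ha : 0 < a) : q * (log a - log q) ≤ a - q := by
  rcases hq.eq_or_lt with rfl | hq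
  · simpa using ha.le
  · rw [← log_div ha.ne' hq.ne']
    have := log_le_sub_one_of_pos (div_pos ha hq)
    calc q * log (a / q) ≤ q * (a / q - 1) := by gcongr
      _ = a - q := by field_simp

/-- The variational lower bound on the Bernoulli relative entropy. -/
theorem neg_log_sub_le_bernoulliKL {p q : ℝ} (hp : p ∈ Set.Ioo (0 : ℝ) 1)
    (hq : q ∈ Set.Icc (0 : ℝ) 1) (γ : ℝ) :
    -log (1 - (1 - exp (-γ)) * p) - γ * q ≤ bernoulliKL q p := by
  obtain ⟨hp0, hp1⟩ := hp
  have hp1' : 0 < 1 - p := by linarith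
  set s := 1 - (1 - exp (-γ)) * p with hs
  have hs0 : 0 < s := by
    have : 0 < exp (-γ) * p := by positivity
    linarith
  have h1 := mul_log_div_le hq.1 (a := p * exp (-γ) / s) (by positivity)
  have h2 := mul_log_div_le (q := 1 - q) (by linarith [hq.2]) (a := (1 - p) / s) (by positivity)
  have h3 : p * exp (-γ) / s + (1 - p) / s = 1 := by
    rw [← add_div, div_eq_one_iff_eq hs0.ne']
    ring
  rw [log_div (by positivity) hs0.ne', log_mul hp0.ne' (exp_ne_zero _), log_exp] at h1
  rw [log_div hp1'.ne' hs0.ne'] at h2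
  rw [bernoulliKL, binEntropy, log_inv, log_inv]
  linarith

theorem mul_exp_bernoulliKL {n k : ℕ} (hn : 0 < n) (hk : k ≤ n) {p : ℝ}
    (hp : p ∈ Set.Ioo (0 : ℝ) 1) :
    p ^ k * (1 - p) ^ (n - k) * exp (n * bernoulliKL (k / n) p)
      = (k / n : ℝ) ^ k * (1 - k / n : ℝ) ^ (n - k) := by
  have hn' : (0 : ℝ) < n := by exact_mod_cast hn
  have hpow : ∀ (m : ℕ) (x : ℝ), x = m / n → x ^ m = exp (m * log x) := by
    rintro m x rfl
    rcases m.eq_zero_or_pos with rfl | hm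
    · simp
    · rw [← log_pow, exp_log (by positivity)]
  have hpow' : ∀ (m : ℕ) (x : ℝ), 0 < x → x ^ m = exp (m * log x) := by
    intro m x hx
    rw [← log_pow, exp_log (by positivity)]
  have hnk : (1 - k / n : ℝ) = ((n - k : ℕ) : ℝ) / n := by
    rw [Nat.cast_sub hk]
    field_simp
  rw [hpow k _ rfl, hpow (n - k) _ hnk, hpow' _ p hp.1, hpow' _ (1 - p) (by linarith [hp.2]),
    ← exp_add, ← exp_add, ← exp_add, bernoulliKL, binEntropy, log_inv, log_inv]
  congr 1
  rw [Nat.cast_sub hk]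
  field_simp
  ring

/-- A convex function of the mean of points of the unit interval is at most its expectation when the
points are replaced by independent Bernoulli variables with the same means. -/
theorem ConvexOn.map_mean_le_sum_powerset {ι : Type*} [Fintype ι] [DecidableEq ι] [Nonempty ι]
    {g : ℝ → ℝ} (hg : ConvexOn ℝ (Set.Icc 0 1) g) {x : ι → ℝ} (hx : ∀ i, x i ∈ Set.Icc (0 : ℝ) 1) :
    g ((Fintype.card ι : ℝ)⁻¹ * ∑ i, x i) ≤
      ∑ s ∈ Finset.univ.powerset, (∏ i, if i ∈ s then x i else 1 - x i)
        * g (s.card / Fintype.card ι) := by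
  have hcard : (0 : ℝ) < Fintype.card ι := by exact_mod_cast Fintype.card_pos
  have hprod : ∀ u v : ι → ℝ, ∑ s ∈ Finset.univ.powerset, (∏ i, if i ∈ s then u i else v i)
      = ∏ i, (u i + v i) := by
    intro u v
    rw [Finset.prod_add]
    refine Finset.sum_congr rfl fun s _ => ?_
    rw [Finset.prod_ite]
    congr 2 <;> ext i <;> simp
  set w : Finset ι → ℝ := fun s => ∏ i, if i ∈ s then x i else 1 - x i with hw
  have hmem : ∀ i, ∑ s ∈ Finset.univ.powerset, w s * (if i ∈ s then 1 else 0) = x i := by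
    intro i
    have h := hprod x (fun j => (1 - x j) * if j = i then 0 else 1)
    rw [Finset.prod_eq_single i (fun j _ hj => by simp [hj]) (by simp)] at h
    simp only [if_true, mul_zero, add_zero] at h
    rw [← h]
    refine Finset.sum_congr rfl fun s _ => ?_
    by_cases his : i ∈ s
    · rw [if_pos his, mul_one]
      refine Finset.prod_congr rfl fun j _ => ?_
      by_cases hj : j = i
      · simp [hj, his]
      · simp [hj]
    · rw [if_neg his, mul_zero]
      exact (Finset.prod_eq_zero (Finset.mem_univ i) (by simp [his])).symm
  have hmean : ∑ s ∈ Finset.univ.powerset, w s • ((s.card : ℝ) / Fintype.card ι)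
      = (Fintype.card ι : ℝ)⁻¹ * ∑ i, x i := by
    have : ∀ s : Finset ι, (s.card : ℝ) = ∑ i, if i ∈ s then (1 : ℝ) else 0 := by
      intro s
      simp
    simp_rw [smul_eq_mul, this, ← mul_div_assoc, ← Finset.sum_div, Finset.mul_sum]
    rw [Finset.sum_comm]
    simp_rw [hmem]
    rw [div_eq_inv_mul]
    simp [Finset.mul_sum]
  rw [← hmean]
  refine hg.map_sum_le (fun s _ => Finset.prod_nonneg fun i _ => ?_) ?_ fun s _ => ?_
  · split_ifs
    · exact (hx i).1
    · linarith [(hx i).2]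
  · rw [hprod]
    simp
  · exact ⟨by positivity, (div_le_one hcard).2 (by exact_mod_cast s.card_le_univ)⟩

theorem lintegral_convex_mean_le {𝒵 : Type*} [MeasurableSpace 𝒵] (μ : Measure 𝒵)
    [IsProbabilityMeasure μ] {n : ℕ} (hn : 0 < n) {f : 𝒵 → ℝ} (hf : Measurable f)
    (hf01 : ∀ z, f z ∈ Set.Icc (0 : ℝ) 1) {g : ℝ → ℝ} (hg : ConvexOn ℝ (Set.Icc 0 1) g)
    (hg0 : ∀ q, 0 ≤ g q) :
    ∫⁻ ω, ENNReal.ofReal (g ((n : ℝ)⁻¹ * ∑ i, f (ω i))) ∂(Measure.pi fun _ : Fin n => μ)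
      ≤ ENNReal.ofReal (∑ k ∈ Finset.range (n + 1), (n.choose k : ℝ) *
        ((∫ z, f z ∂μ) ^ k * (1 - ∫ z, f z ∂μ) ^ (n - k) * g (k / n))) := by
  have : Nonempty (Fin n) := ⟨⟨0, hn⟩⟩
  have hint : Integrable f μ := Integrable.of_bound hf.aestronglyMeasurable 1
    (.of_forall fun z => by rw [norm_eq_abs, abs_of_nonneg (hf01 z).1]; exact (hf01 z).2)
  set F : Finset (Fin n) → (i : Fin n) → 𝒵 → ℝ :=
    fun s i z => if i ∈ s then f z else 1 - f z with hF
  have hFint : ∀ s i, Integrable (F s i) μ := by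
    intro s i
    by_cases h : i ∈ s
    · simpa [hF, h] using hint
    · simp only [hF, h, if_false]
      exact (integrable_const (1 : ℝ)).sub hint
  have hFnonneg : ∀ s i z, 0 ≤ F s i z := by
    intro s i z
    simp only [hF]
    split_ifs
    · exact (hf01 z).1
    · linarith [(hf01 z).2]
  have hprodint : ∀ s, Integrable (fun ω : Fin n → 𝒵 => (∏ i, F s i (ω i)) * g (s.card / n))
      (Measure.pi fun _ : Fin n => μ) :=
    fun s => (Integrable.fintype_prod (hFint s)).mul_const _
  calc _ ≤ ∫⁻ ω, ENNReal.ofReal (∑ s ∈ (Finset.univ : Finset (Fin n)).powerset,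
        (∏ i, F s i (ω i)) * g (s.card / n)) ∂(Measure.pi fun _ : Fin n => μ) := by
        refine lintegral_mono fun ω => ENNReal.ofReal_le_ofReal ?_
        have := hg.map_mean_le_sum_powerset (x := fun i => f (ω i)) fun i => hf01 (ω i)
        simpa only [Fintype.card_fin] using this
    _ = ENNReal.ofReal (∑ s ∈ (Finset.univ : Finset (Fin n)).powerset,
        (∫ z, f z ∂μ) ^ s.card * (1 - ∫ z, f z ∂μ) ^ (n - s.card) * g (s.card / n)) := by
        rw [← ofReal_integral_eq_lintegral_ofReal (integrable_finsetSum _ fun s _ => hprodint s)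
          (.of_forall fun ω => Finset.sum_nonneg fun s _ =>
            mul_nonneg (Finset.prod_nonneg fun i _ => hFnonneg s i _) (hg0 _)),
          integral_finsetSum _ fun s _ => hprodint s]
        congr 1
        refine Finset.sum_congr rfl fun s _ => ?_
        rw [integral_mul_const, integral_fintype_prod_eq_prod]
        have hFi : ∀ i, ∫ z, F s i z ∂μ
            = if i ∈ s then ∫ z, f z ∂μ else 1 - ∫ z, f z ∂μ := by
          intro i
          by_cases h : i ∈ s
          · simp [hF, h]
          · simp [hF, h, integral_sub (integrable_const (1 : ℝ)) hint]
        simp_rw [hFi]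
        rw [Finset.prod_ite, Finset.prod_const, Finset.prod_const, Finset.filter_not]
        simp [Finset.card_sdiff]
    _ = _ := by
        rw [Finset.sum_powerset_apply_card (fun k =>
          (∫ z, f z ∂μ) ^ k * (1 - ∫ z, f z ∂μ) ^ (n - k) * g (k / n))]
        simp

/-- Exponential of `n` times the Bernoulli relative entropy, with its infinite values. -/
noncomputable def expBernoulliKL (n : ℕ) (p q : ℝ) : ℝ≥0∞ :=
  if (p = 0 ∨ p = 1) ∧ q ≠ p then ∞ else ENNReal.ofReal (exp (n * bernoulliKL q p))

theorem measurable_expBernoulliKL (n : ℕ) :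
    Measurable fun x : ℝ × ℝ => expBernoulliKL n x.1 x.2 := by
  have hb : Measurable binEntropy := binEntropy_continuous.measurable
  unfold expBernoulliKL bernoulliKL
  refine Measurable.ite ?_ measurable_const (by fun_prop)
  refine (((measurableSet_eq_fun measurable_fst measurable_const).union
    (measurableSet_eq_fun measurable_fst measurable_const))).inter
    (measurableSet_eq_fun measurable_snd measurable_fst).compl

theorem ofReal_exp_le_expBernoulliKL (n : ℕ) {p q : ℝ} (hp : p ∈ Set.Icc (0 : ℝ) 1)
    (hq : q ∈ Set.Icc (0 : ℝ) 1) (γ : ℝ) :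
    ENNReal.ofReal (exp (n * (-log (1 - (1 - exp (-γ)) * p) - γ * q))) ≤ expBernoulliKL n p q := by
  rw [expBernoulliKL]
  split_ifs with h
  · exact le_top
  · refine ENNReal.ofReal_le_ofReal (exp_le_exp.2 (mul_le_mul_of_nonneg_left ?_ n.cast_nonneg))
    by_cases hp' : p = 0 ∨ p = 1
    · obtain rfl : q = p := by
        by_contra hne
        exact h ⟨hp', hne⟩
      rcases hp' with rfl | rfl <;> simp [bernoulliKL]
    · push Not at hp'
      exact neg_log_sub_le_bernoulliKL ⟨lt_of_le_of_ne hp.1 hp'.1.symm, lt_of_le_of_ne hp.2 hp'.2⟩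
        hq γ

theorem integral_mem_Icc {α : Type*} [MeasurableSpace α] (μ : Measure α) [IsProbabilityMeasure μ]
    {f : α → ℝ} (hf : Integrable f μ) (hf01 : ∀ z, f z ∈ Set.Icc (0 : ℝ) 1) :
    ∫ z, f z ∂μ ∈ Set.Icc (0 : ℝ) 1 := by
  refine ⟨integral_nonneg fun z => (hf01 z).1, ?_⟩
  simpa using integral_mono hf (integrable_const 1) fun z => (hf01 z).2

theorem ae_eq_integral_of_eq_zero_or_one {α : Type*} [MeasurableSpace α] (μ : Measure α)
    [IsProbabilityMeasure μ] {f : α → ℝ} (hf : Integrable f μ)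
    (hf01 : ∀ z, f z ∈ Set.Icc (0 : ℝ) 1) (h : ∫ z, f z ∂μ = 0 ∨ ∫ z, f z ∂μ = 1) :
    ∀ᵐ z ∂μ, f z = ∫ z, f z ∂μ := by
  rcases h with h | h
  · rw [h]
    exact (integral_eq_zero_iff_of_nonneg (fun z => (hf01 z).1) hf).1 h
  · have h0 : ∫ z, (1 - f z) ∂μ = 0 := by
      rw [integral_sub (integrable_const _) hf, h]
      simp
    have h1 := (integral_eq_zero_iff_of_nonneg (fun z => sub_nonneg.2 (hf01 z).2)
      ((integrable_const _).sub hf)).1 h0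
    filter_upwards [h1] with z hz
    simp only [Pi.zero_apply] at hz
    linarith

/-- **Maurer's lemma.** -/
theorem lintegral_expBernoulliKL_le {𝒵 : Type*} [MeasurableSpace 𝒵] (μ : Measure 𝒵)
    [IsProbabilityMeasure μ] {n : ℕ} (hn : 0 < n) {f : 𝒵 → ℝ} (hf : Measurable f)
    (hf01 : ∀ z, f z ∈ Set.Icc (0 : ℝ) 1) :
    ∫⁻ ω, expBernoulliKL n (∫ z, f z ∂μ) ((n : ℝ)⁻¹ * ∑ i, f (ω i))
        ∂(Measure.pi fun _ : Fin n => μ)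
      ≤ ENNReal.ofReal (exp (1 / (12 * n)) * √(π * n / 2) + 2) := by
  have hint : Integrable f μ := Integrable.of_bound hf.aestronglyMeasurable 1
    (.of_forall fun z => by rw [norm_eq_abs, abs_of_nonneg (hf01 z).1]; exact (hf01 z).2)
  have hp := integral_mem_Icc μ hint hf01
  by_cases h : ∫ z, f z ∂μ = 0 ∨ ∫ z, f z ∂μ = 1
  · have hae : ∀ᵐ ω ∂(Measure.pi fun _ : Fin n => μ),
        expBernoulliKL n (∫ z, f z ∂μ) ((n : ℝ)⁻¹ * ∑ i, f (ω i)) = 1 := by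
      have hall : ∀ᵐ ω ∂(Measure.pi fun _ : Fin n => μ), ∀ i, f (ω i) = ∫ z, f z ∂μ :=
        ae_all_iff.2 fun i => (Measure.quasiMeasurePreserving_eval (fun _ : Fin n => μ) i).ae
          (ae_eq_integral_of_eq_zero_or_one μ hint hf01 h)
      filter_upwards [hall] with ω hω
      have hn' : (n : ℝ) ≠ 0 := by exact_mod_cast hn.ne'
      have hmean : (n : ℝ)⁻¹ * ∑ i, f (ω i) = ∫ z, f z ∂μ := by
        simp [hω, hn']
      rw [hmean, expBernoulliKL, if_neg (by simp)]
      rcases h with h | h <;> simp [h, bernoulliKL]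
    rw [lintegral_congr_ae hae]
    simp only [lintegral_const, measure_univ, mul_one]
    rw [← ENNReal.ofReal_one]
    refine ENNReal.ofReal_le_ofReal ?_
    have : 0 ≤ exp (1 / (12 * n)) * √(π * n / 2) := by positivity
    linarith
  · have hp' : ∫ z, f z ∂μ ∈ Set.Ioo (0 : ℝ) 1 := by
      push Not at h
      exact ⟨lt_of_le_of_ne hp.1 h.1.symm, lt_of_le_of_ne hp.2 h.2⟩
    simp_rw [expBernoulliKL, h, false_and, if_false]
    refine (lintegral_convex_mean_le μ hn hf hf01 (convexOn_exp_mul_bernoulliKL n _)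
      fun q => (exp_pos _).le).trans (ENNReal.ofReal_le_ofReal ?_)
    refine le_of_eq_of_le (Finset.sum_congr rfl fun k hk => ?_) (sum_choose_mul_pow_le hn)
    rw [mul_exp_bernoulliKL hn (Nat.lt_succ_iff.1 (Finset.mem_range.1 hk)) hp']

/-- The Donsker–Varadhan change-of-measure inequality. -/
theorem integral_le_integral_llr_add_log {α : Type*} [MeasurableSpace α] {μ ν : Measure α}
    [IsProbabilityMeasure μ] [IsProbabilityMeasure ν] (hμν : μ ≪ ν)
    (hllr : Integrable (llr μ ν) μ) {f : α → ℝ} (hfμ : Integrable f μ)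
    (hfν : Integrable (fun x => exp (f x)) ν) :
    ∫ x, f x ∂μ ≤ ∫ x, llr μ ν x ∂μ + log (∫ x, exp (f x) ∂ν) := by
  have : IsProbabilityMeasure (ν.tilted f) := isProbabilityMeasure_tilted hfν
  have hac : μ ≪ ν.tilted f := hμν.trans (absolutelyContinuous_tilted hfν)
  have h1 := integral_llr_tilted_right hμν hfμ hfν hllr
  have h2 := InformationTheory.toReal_klDiv_of_measure_eq hac (by simp)
  have h3 : 0 ≤ (InformationTheory.klDiv μ (ν.tilted f)).toReal := ENNReal.toReal_nonneg
  linarith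

/-- Jensen's inequality for the logarithm of an affine function of `L`. -/
theorem integral_log_one_sub_mul_le {α : Type*} [MeasurableSpace α] (Q : Measure α)
    [IsProbabilityMeasure Q] {L : α → ℝ} (hL : Integrable L Q)
    (hL01 : ∀ x, L x ∈ Set.Icc (0 : ℝ) 1) {a : ℝ} (ha0 : 0 ≤ a) (ha1 : a < 1)
    (hlog : Integrable (fun x => log (1 - a * L x)) Q) :
    ∫ x, log (1 - a * L x) ∂Q ≤ log (1 - a * ∫ x, L x ∂Q) := by
  have hpos : ∀ t ∈ Set.Icc (0 : ℝ) 1, 0 < 1 - a * t := fun t ht => by nlinarith [ht.1, ht.2]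
  set s := 1 - a * ∫ x, L x ∂Q with hs
  have hs0 : 0 < s := hpos _ (integral_mem_Icc Q hL hL01)
  have hi : Integrable (fun x => 1 - a * L x) Q := (integrable_const _).sub (hL.const_mul a)
  have hle : ∀ x, log (1 - a * L x) ≤ log s + ((1 - a * L x) / s - 1) := by
    intro x
    have h := log_le_sub_one_of_pos (div_pos (hpos _ (hL01 x)) hs0)
    rw [log_div (hpos _ (hL01 x)).ne' hs0.ne'] at h
    linarith
  have hi' : Integrable (fun x => (1 - a * L x) / s - 1) Q :=
    (hi.div_const s).sub (integrable_const _)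
  have hone : ∫ x, (1 - a * L x) ∂Q = s := by
    rw [integral_sub (integrable_const _) (hL.const_mul a), integral_const_mul]
    simp [hs]
  refine (integral_mono hlog ((integrable_const _).add hi') hle).trans_eq ?_
  simp only [Pi.add_apply]
  rw [integral_add (integrable_const _) hi', integral_sub (hi.div_const s) (integrable_const _),
    integral_div, hone]
  simp [hs0.ne']

/-- The deterministic part of the Catoni bound: a bound on the exponential moment of the
relative entropy under the prior controls every posterior and every temperature. -/
theorem catoni_bound_of_lintegral_le {Θ : Type*} [MeasurableSpace Θ] (Pri : Measure Θ)
    [IsProbabilityMeasure Pri] {n : ℕ} (hn : 0 < n) {L R : Θ → ℝ} (hL : Measurable L)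
    (hR : Measurable R) (hL01 : ∀ θ, L θ ∈ Set.Icc (0 : ℝ) 1)
    (hR01 : ∀ θ, R θ ∈ Set.Icc (0 : ℝ) 1) {C : ℝ} (hC : 0 < C)
    (hG : ∫⁻ θ, expBernoulliKL n (L θ) (R θ) ∂Pri ≤ ENNReal.ofReal C)
    (Q : Measure Θ) [IsProbabilityMeasure Q] (hQ : Q ≪ Pri) (hllr : Integrable (llr Q Pri) Q)
    {γ : ℝ} (hγ : 0 < γ) :
    ∫ θ, L θ ∂Q ≤ (1 - exp (-((KLreal Q Pri + log C) / n) - γ * ∫ θ, R θ ∂Q))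
      / (1 - exp (-γ)) := by
  have hn' : (0 : ℝ) < n := by exact_mod_cast hn
  have hexp1 : exp (-γ) < 1 := by simpa using hγ
  set a := 1 - exp (-γ) with ha
  have ha0 : 0 < a := by linarith
  have ha1 : a < 1 := by linarith [exp_pos (-γ)]
  have hbdd : ∀ {f : Θ → ℝ}, (∀ θ, f θ ∈ Set.Icc (0 : ℝ) 1) → ∀ θ, ‖f θ‖ ≤ 1 := by
    intro f hf θ
    rw [norm_eq_abs, abs_of_nonneg (hf θ).1]
    exact (hf θ).2
  have hLi : Integrable L Q :=
    Integrable.of_bound hL.aestronglyMeasurable 1 (.of_forall (hbdd hL01))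
  have hRi : Integrable R Q :=
    Integrable.of_bound hR.aestronglyMeasurable 1 (.of_forall (hbdd hR01))
  have hrange : ∀ t ∈ Set.Icc (0 : ℝ) 1, exp (-γ) ≤ 1 - a * t ∧ 1 - a * t ≤ 1 :=
    fun t ht => ⟨by nlinarith [ht.1, ht.2], by nlinarith [ht.1, ht.2]⟩
  have hlogrange : ∀ θ, -γ ≤ log (1 - a * L θ) ∧ log (1 - a * L θ) ≤ 0 := by
    intro θ
    obtain ⟨h1, h2⟩ := hrange _ (hL01 θ)
    have h0 : 0 < 1 - a * L θ := (exp_pos _).trans_le h1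
    exact ⟨(le_log_iff_exp_le h0).2 h1, log_nonpos h0.le h2⟩
  have hlogm : Measurable fun θ => log (1 - a * L θ) := by fun_prop
  have hlogi : Integrable (fun θ => log (1 - a * L θ)) Q :=
    Integrable.of_bound hlogm.aestronglyMeasurable γ (.of_forall fun θ => by
      rw [norm_eq_abs, abs_le]
      exact ⟨(hlogrange θ).1, (hlogrange θ).2.trans hγ.le⟩)
  set h : Θ → ℝ := fun θ => n * (-log (1 - a * L θ) - γ * R θ) with hh
  have hhi : Integrable h Q := (hlogi.neg.sub (hRi.const_mul γ)).const_mul _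
  have hhm : Measurable h := by fun_prop
  have hhle : ∀ θ, h θ ≤ n * γ := fun θ =>
    mul_le_mul_of_nonneg_left
      (by linarith [(hlogrange θ).1, mul_nonneg hγ.le (hR01 θ).1]) n.cast_nonneg
  have hei : Integrable (fun θ => exp (h θ)) Pri :=
    Integrable.of_bound (by fun_prop) (exp (n * γ)) (.of_forall fun θ => by
      rw [norm_eq_abs, abs_of_pos (exp_pos _)]
      exact exp_le_exp.2 (hhle θ))
  have hmoment : ∫ θ, exp (h θ) ∂Pri ≤ C := by
    rw [← ENNReal.ofReal_le_ofReal_iff hC.le,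
      ofReal_integral_eq_lintegral_ofReal hei (.of_forall fun θ => (exp_pos _).le)]
    exact (lintegral_mono fun θ =>
      ofReal_exp_le_expBernoulliKL n (hL01 θ) (hR01 θ) γ).trans hG
  have hdv := integral_le_integral_llr_add_log hQ hllr hhi hei
  have hlogC : log (∫ θ, exp (h θ) ∂Pri) ≤ log C := log_le_log (integral_exp_pos hei) hmoment
  have hnegi : Integrable (fun θ => -log (1 - a * L θ)) Q := hlogi.neg
  have hint : ∫ θ, h θ ∂Q = n * (-∫ θ, log (1 - a * L θ) ∂Q - γ * ∫ θ, R θ ∂Q) := by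
    rw [hh, integral_const_mul, integral_sub hnegi (hRi.const_mul γ), integral_neg,
      integral_const_mul]
  have hjensen := integral_log_one_sub_mul_le Q hLi hL01 ha0.le ha1 hlogi
  have hmain : -log (1 - a * ∫ θ, L θ ∂Q) - γ * ∫ θ, R θ ∂Q ≤ (KLreal Q Pri + log C) / n := by
    rw [le_div_iff₀ hn', KLreal]
    nlinarith
  have hpos : 0 < 1 - a * ∫ θ, L θ ∂Q :=
    (exp_pos _).trans_le (hrange _ (integral_mem_Icc Q hLi hL01)).1
  have hfin := (le_log_iff_exp_le hpos).1
    (show -((KLreal Q Pri + log C) / n) - γ * ∫ θ, R θ ∂Q ≤ log (1 - a * ∫ θ, L θ ∂Q) by linarith)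
  rw [le_div_iff₀ ha0]
  linarith

theorem ofReal_one_sub_le_measure_of_lintegral_le {Ω : Type*} [MeasurableSpace Ω] (P : Measure Ω)
    [IsProbabilityMeasure P] {X : Ω → ℝ≥0∞} (hX : Measurable X) {c δ : ℝ} (hc : 0 < c)
    (hδ : 0 < δ) (hle : ∫⁻ ω, X ω ∂P ≤ ENNReal.ofReal c) :
    ENNReal.ofReal (1 - δ) ≤ P {ω | X ω ≤ ENNReal.ofReal (c / δ)} := by
  have hmeas : MeasurableSet {ω | X ω ≤ ENNReal.ofReal (c / δ)} := hX measurableSet_Iic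
  have hcd : 0 < c / δ := div_pos hc hδ
  have hbad : P {ω | X ω ≤ ENNReal.ofReal (c / δ)}ᶜ ≤ ENNReal.ofReal δ := by
    calc P {ω | X ω ≤ ENNReal.ofReal (c / δ)}ᶜ ≤ P {ω | ENNReal.ofReal (c / δ) ≤ X ω} :=
          measure_mono fun ω hω => (not_le.1 (Set.notMem_ofPred_iff.1 hω)).le
      _ ≤ (∫⁻ ω, X ω ∂P) / ENNReal.ofReal (c / δ) :=
          meas_ge_le_lintegral_div hX.aemeasurable (by simpa using hcd) ENNReal.ofReal_ne_top
      _ ≤ ENNReal.ofReal c / ENNReal.ofReal (c / δ) := by gcongr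
      _ = ENNReal.ofReal δ := by
          rw [← ENNReal.ofReal_div_of_pos hcd]
          congr 1
          field_simp
  rw [ENNReal.ofReal_sub _ hδ.le, ENNReal.ofReal_one, tsub_le_iff_right,
    ← prob_add_prob_compl (μ := P) hmeas]
  gcongr

theorem lintegral_lintegral_le_of_forall {Θ Ω : Type*} [MeasurableSpace Θ] [MeasurableSpace Ω]
    (ν : Measure Θ) [IsProbabilityMeasure ν] (P : Measure Ω) [IsProbabilityMeasure P]
    {G : Θ × Ω → ℝ≥0∞} (hG : Measurable G) {c : ℝ≥0∞} (hle : ∀ θ, ∫⁻ ω, G (θ, ω) ∂P ≤ c) :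
    ∫⁻ ω, ∫⁻ θ, G (θ, ω) ∂ν ∂P ≤ c := by
  rw [← lintegral_prod_symm' G hG, lintegral_prod G hG.aemeasurable]
  exact (lintegral_mono hle).trans_eq (by simp)

/-- **Uniform Catoni bound for bounded losses.** -/
theorem uniform_catoni
    {Θ 𝒵 : Type*} [MeasurableSpace Θ] [MeasurableSpace 𝒵]
    (Pri : Measure Θ) [IsProbabilityMeasure Pri]
    (μZ : Measure 𝒵) [IsProbabilityMeasure μZ]
    (n : ℕ) (hn : 0 < n)
    (ℓ : Θ → 𝒵 → ℝ) (hℓ : Measurable fun q : Θ × 𝒵 => ℓ q.1 q.2)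
    (hℓ01 : ∀ θ z, ℓ θ z ∈ Set.Icc (0 : ℝ) 1)
    (δ : ℝ) (hδ : δ ∈ Set.Ioo (0 : ℝ) 1) :
    ENNReal.ofReal (1 - δ) ≤
      (Measure.pi fun _ : Fin n => μZ)
        {ωs | ∀ Q : Measure Θ, IsProbabilityMeasure Q → Q ≪ Pri →
          Integrable (llr Q Pri) Q → ∀ γ : ℝ, 0 < γ →
          (∫ θ, (∫ z, ℓ θ z ∂μZ) ∂Q)
            ≤ (1 - Real.exp (-((KLreal Q Pri
                    + Real.log ((Real.exp (1 / (12 * n)) * Real.sqrt (π * n / 2) + 2) / δ))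
                      / n)
                  - γ * ∫ θ, (n : ℝ)⁻¹ * ∑ i, ℓ θ (ωs i) ∂Q))
              / (1 - Real.exp (-γ))} := by
  set P := Measure.pi fun _ : Fin n => μZ
  set ξ : ℝ := exp (1 / (12 * n)) * √(π * n / 2) + 2 with hξ
  have hξ0 : 0 < ξ := by positivity
  have hL : Measurable fun θ => ∫ z, ℓ θ z ∂μZ :=
    (hℓ.stronglyMeasurable.integral_prod_right (ν := μZ)).measurable
  have hℓs : ∀ θ, Measurable (ℓ θ) := fun θ => hℓ.comp measurable_prodMk_left
  have hL01 : ∀ θ, ∫ z, ℓ θ z ∂μZ ∈ Set.Icc (0 : ℝ) 1 := fun θ =>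
    integral_mem_Icc μZ (Integrable.of_bound (hℓs θ).aestronglyMeasurable 1
      (.of_forall fun z => by
        rw [norm_eq_abs, abs_of_nonneg (hℓ01 θ z).1]
        exact (hℓ01 θ z).2)) (hℓ01 θ)
  have hR : Measurable fun x : Θ × (Fin n → 𝒵) => (n : ℝ)⁻¹ * ∑ i, ℓ x.1 (x.2 i) := by
    refine measurable_const.mul (Finset.measurable_sum _ fun i _ => ?_)
    exact hℓ.comp (measurable_fst.prodMk ((measurable_pi_apply i).comp measurable_snd))
  have hn' : (0 : ℝ) < n := by exact_mod_cast hn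
  have hR01 : ∀ (ω : Fin n → 𝒵) θ, (n : ℝ)⁻¹ * ∑ i, ℓ θ (ω i) ∈ Set.Icc (0 : ℝ) 1 := by
    refine fun ω θ => ⟨mul_nonneg (by positivity) (Finset.sum_nonneg fun i _ => (hℓ01 _ _).1), ?_⟩
    rw [inv_mul_le_iff₀ hn']
    simpa using Finset.sum_le_card_nsmul Finset.univ (fun i => ℓ θ (ω i)) 1 fun i _ => (hℓ01 _ _).2
  have hG : Measurable fun x : Θ × (Fin n → 𝒵) =>
      expBernoulliKL n (∫ z, ℓ x.1 z ∂μZ) ((n : ℝ)⁻¹ * ∑ i, ℓ x.1 (x.2 i)) :=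
    (measurable_expBernoulliKL n).comp ((hL.comp measurable_fst).prodMk hR)
  have hX := lintegral_lintegral_le_of_forall Pri P hG fun θ =>
    lintegral_expBernoulliKL_le μZ hn (hℓs θ) (hℓ01 θ)
  refine (ofReal_one_sub_le_measure_of_lintegral_le P hG.lintegral_prod_left' hξ0 hδ.1 hX).trans
    (measure_mono fun ω hω Q hQp hQ hllr γ hγ => ?_)
  exact catoni_bound_of_lintegral_le Pri hn hL (hR.comp measurable_prodMk_right) hL01 (hR01 ω)
    (div_pos hξ0 hδ.1) hω Q hQ hllr hγ
end

section
/- Define L̂_val,n(Q) := (c_ε − V̂_{R̲,n}(d_Q))/K_ε, c_{n,δ}(Q) := (KL(Q‖Π0) + log(ξ(n)/δ))/n with ξ(n) := exp(1/(12n))·√(πn/2) + 2, and for γ > 0 the lower confidence bound LCB_{n,δ}(Q; γ) := c_ε − K_ε · (1 − exp(−c_{n,δ}(Q) − γ·L̂_val,n(Q))) / (1 − exp(−γ)). Then: (a) with probability at least 1 − δ, V*(d_Q) ≥ LCB_{n,δ}(Q; γ) holds simultaneously for all posteriors Q ≪ Π0 and all γ > 0; (b) for fixed γ, the map Q ↦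 LCB_{n,δ}(Q; γ) is uniquely maximized over Q ≪ Π0 by the Gibbs posterior Q̂_γ(dθ) ∝ exp( (γ n / K_ε)·V̂_{R̲,n}(d_θ) ) Π0(dθ); and (c) for any finite grid 𝒯_n ⊂ (0,∞), any γ̂ ∈ argmax_{γ ∈ 𝒯_n} LCB_{n,δ}(Q̂_γ; γ) satisfies, on the event of (a), V*(d_{Q̂_{γ̂}}) ≥ max_{γ ∈ 𝒯_n} LCB_{n,δ}(Q̂_γ; γ). -/
open MeasureTheory ProbabilityTheory Real
open scoped ENNReal

/-- the certified lower reward `R̲ = (R − U(X,A,R))₊` -/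
noncomputable def Rlow {Ω 𝒳 : Type*} (X : Ω → 𝒳) (A : Ω → ℤ) (R : Ω → ℝ)
    (U : 𝒳 → ℤ → ℝ → ℝ) (ω : Ω) : ℝ :=
  max (R ω - U (X ω) (A ω) (R ω)) 0

/-- the doubly robust score `Γ_a^α(Z)` -/
noncomputable def Gam {Ω 𝒳 𝒜 : Type*} (X : Ω → 𝒳) (A : Ω → ℤ) (pr : ℤ → 𝒳 → ℝ)
    (ν : ℤ → 𝒳 → 𝒜 → ℝ) (Rl : Ω → ℝ) (a : ℤ) (α : 𝒜) (ω : Ω) : ℝ :=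
  ν a (X ω) α + (if A ω = a then (1 : ℝ) else 0) / pr a (X ω) * (Rl ω - ν a (X ω) α)

/-- the empirical certified value `V̂_{R̲,n}(d_θ)` of `θ = (β,α)` on the sample `ωs` -/
noncomputable def Vhat {Ω 𝒳 𝒜 ℬ : Type*} (X : Ω → 𝒳) (A : Ω → ℤ) (pr : ℤ → 𝒳 → ℝ)
    (ν : ℤ → 𝒳 → 𝒜 → ℝ) (Rl : Ω → ℝ) (f : 𝒳 → ℬ → ℝ) (n : ℕ)
    (θ : ℬ × 𝒜) (ωs : Fin n → Ω) : ℝ :=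
  (n : ℝ)⁻¹ * ∑ i, Gam X A pr ν Rl
    (if 0 ≤ f (X (ωs i)) θ.1 then 1 else -1) θ.2 (ωs i)

/-- the posterior-aggregated empirical certified value `V̂_{R̲,n}(d_Q)` -/
noncomputable def VhatQ {Ω 𝒳 𝒜 ℬ : Type*} [MeasurableSpace 𝒜] [MeasurableSpace ℬ]
    (X : Ω → 𝒳) (A : Ω → ℤ) (pr : ℤ → 𝒳 → ℝ)
    (ν : ℤ → 𝒳 → 𝒜 → ℝ) (Rl : Ω → ℝ) (f : 𝒳 → ℬ → ℝ) (n : ℕ)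
    (Q : Measure (ℬ × 𝒜)) (ωs : Fin n → Ω) : ℝ :=
  ∫ θ, Vhat X A pr ν Rl f n θ ωs ∂Q

/-- the posterior-aggregated target value `V*(d_Q)` -/
noncomputable def VstarQ {Ω 𝒳 𝒜 ℬ : Type*} [MeasurableSpace Ω]
    [MeasurableSpace 𝒜] [MeasurableSpace ℬ]
    (P : Measure Ω) (X : Ω → 𝒳) (Rstarpot : ℤ → Ω → ℝ) (f : 𝒳 → ℬ → ℝ)
    (Q : Measure (ℬ × 𝒜)) : ℝ :=
  ∫ θ, (∫ ω, Rstarpot (if 0 ≤ f (X ω) θ.1 then 1 else -1) ω ∂P) ∂Q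

/-- the empirical lower confidence bound `LCB_{n,δ}(Q;γ)`, written in terms of
`kl = KL(Q‖Π0)` and `vhat = V̂_{R̲,n}(d_Q)`:
`LCB = c_ε − K_ε·(1 − exp(−c_{n,δ}(Q) − γ·L̂_val,n(Q)))/(1 − exp(−γ))`. -/
noncomputable def LCB (ε δ : ℝ) (n : ℕ) (kl vhat γ : ℝ) : ℝ :=
  ε⁻¹ - (2 * ε⁻¹ - 1) *
    (1 - Real.exp (-((kl + Real.log
          ((Real.exp (1 / (12 * n)) * Real.sqrt (π * n / 2) + 2) / δ)) / n)
        - γ * ((ε⁻¹ - vhat) / (2 * ε⁻¹ - 1))))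
    / (1 - Real.exp (-γ))

/-- the Gibbs posterior `Q̂_γ ∝ exp((γn/K_ε)·V̂_{R̲,n}(d_θ)) Π0(dθ)` -/
noncomputable def GibbsPost {Ω 𝒳 𝒜 ℬ : Type*} [MeasurableSpace 𝒜] [MeasurableSpace ℬ]
    (X : Ω → 𝒳) (A : Ω → ℤ) (pr : ℤ → 𝒳 → ℝ)
    (ν : ℤ → 𝒳 → 𝒜 → ℝ) (Rl : Ω → ℝ) (f : 𝒳 → ℬ → ℝ) (n : ℕ) (ε : ℝ)
    (Pri : Measure (ℬ × 𝒜)) (γ : ℝ) (ωs : Fin n → Ω) : Measure (ℬ × 𝒜) :=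
  Pri.tilted fun θ => γ * n / (2 * ε⁻¹ - 1) * Vhat X A pr ν Rl f n θ ωs


theorem sum_choose_mul_pow_mul_pow (n : ℕ) : ∀ x y : ℝ,
    ∑ k ∈ Finset.range (n + 1), (n.choose k : ℝ) * (x + k) ^ k * (y + n - k) ^ (n - k) =
      ∑ j ∈ Finset.range (n + 1), (n.descFactorial j : ℝ) * (x + y + n) ^ (n - j) := by
  induction n with
  | zero => intro x y; simp
  | succ n ih =>
    intro x y
    have hl : ∀ y : ℝ, HasDerivAt (fun y : ℝ => ∑ k ∈ Finset.range (n + 2),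
        ((n + 1).choose k : ℝ) * (x + k) ^ k * (y + (n + 1 : ℕ) - k) ^ (n + 1 - k))
        ((n + 1) * ∑ k ∈ Finset.range (n + 1),
          (n.choose k : ℝ) * (x + k) ^ k * ((y + 1) + n - k) ^ (n - k)) y := by
      intro y
      have h := HasDerivAt.fun_sum (u := Finset.range (n + 2))
        (A := fun k (y : ℝ) =>
          ((n + 1).choose k : ℝ) * (x + k) ^ k * (y + (n + 1 : ℕ) - k) ^ (n + 1 - k))
        (x := y) (fun k _ =>
          ((((hasDerivAt_id y).add_const ((n + 1 : ℕ) : ℝ)).sub_const (k : ℝ)).pow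
            (n + 1 - k)).const_mul (((n + 1).choose k : ℝ) * (x + k) ^ k))
      refine h.congr_deriv (Eq.symm ?_)
      rw [Finset.sum_range_succ _ (n + 1), Finset.mul_sum]
      simp only [Nat.sub_self, Nat.cast_zero, zero_mul, mul_zero, add_zero]
      refine Finset.sum_congr rfl fun k hk => ?_
      have hk' : k ≤ n := by simpa [Nat.lt_succ_iff] using hk
      have hc : ((n + 1).choose k : ℝ) * ((n + 1 - k : ℕ) : ℝ) = (n + 1) * n.choose k := by
        exact_mod_cast (Nat.choose_mul_succ_eq n k).symm.trans (mul_comm _ _)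
      have he : n + 1 - k - 1 = n - k := by omega
      simp only [he, id]
      push_cast
      rw [show y + 1 + (n : ℝ) - k = y + (n + 1) - k by ring]
      linear_combination (-(x + k) ^ k * (y + (n + 1) - k) ^ (n - k)) * hc
    have hr : ∀ y : ℝ, HasDerivAt (fun y : ℝ => ∑ j ∈ Finset.range (n + 2),
        ((n + 1).descFactorial j : ℝ) * (x + y + (n + 1 : ℕ)) ^ (n + 1 - j))
        ((n + 1) * ∑ j ∈ Finset.range (n + 1),
          (n.descFactorial j : ℝ) * (x + (y + 1) + n) ^ (n - j)) y := by
      intro y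
      have h := HasDerivAt.fun_sum (u := Finset.range (n + 2))
        (A := fun j (y : ℝ) =>
          ((n + 1).descFactorial j : ℝ) * (x + y + (n + 1 : ℕ)) ^ (n + 1 - j))
        (x := y) (fun j _ =>
          ((((hasDerivAt_id y).const_add x).add_const ((n + 1 : ℕ) : ℝ)).pow
            (n + 1 - j)).const_mul ((n + 1).descFactorial j : ℝ))
      refine h.congr_deriv (Eq.symm ?_)
      rw [Finset.sum_range_succ _ (n + 1), Finset.mul_sum]
      simp only [Nat.sub_self, Nat.cast_zero, zero_mul, mul_zero, add_zero]
      refine Finset.sum_congr rfl fun j hj => ?_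
      have hc : ((n + 1).descFactorial j : ℝ) * ((n + 1 - j : ℕ) : ℝ) =
          (n + 1) * n.descFactorial j := by
        have := (Nat.descFactorial_succ (n + 1) j).symm.trans (Nat.succ_descFactorial_succ n j)
        rw [mul_comm] at this
        exact_mod_cast this
      have he : n + 1 - j - 1 = n - j := by omega
      simp only [he, id]
      push_cast
      rw [show x + (y + 1) + (n : ℝ) = x + y + (n + 1) by ring]
      linear_combination (-(x + y + (n + 1)) ^ (n - j)) * hc
    have hd : ∀ y : ℝ, HasDerivAt (fun y : ℝ => (∑ k ∈ Finset.range (n + 2),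
        ((n + 1).choose k : ℝ) * (x + k) ^ k * (y + (n + 1 : ℕ) - k) ^ (n + 1 - k)) -
        ∑ j ∈ Finset.range (n + 2),
        ((n + 1).descFactorial j : ℝ) * (x + y + (n + 1 : ℕ)) ^ (n + 1 - j)) 0 y := by
      intro y
      have h := (hl y).sub (hr y)
      rw [ih, sub_self] at h
      exact h
    have hconst := is_const_of_deriv_eq_zero (fun y => (hd y).differentiableAt)
      (fun y => (hd y).deriv) y (-(n + 1 : ℕ) - x)
    rw [← sub_eq_zero, hconst, sub_eq_zero]
    have h1 := congrFun (fwdDiff_iter_eq_factorial (R := ℝ) (n := n + 1)) x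
    rw [fwdDiff_iter_eq_sum_shift] at h1
    trans ((n + 1).factorial : ℝ)
    · simp only [Pi.natCast_apply] at h1
      rw [← h1]
      refine Finset.sum_congr rfl fun k hk => ?_
      have hk' : k ≤ n + 1 := by simpa [Nat.lt_succ_iff] using hk
      rw [show -((n + 1 : ℕ) : ℝ) - x + (n + 1 : ℕ) - k = (-1) * (x + k) by ring, mul_pow]
      simp only [zsmul_eq_mul, nsmul_eq_mul, mul_one]
      push_cast
      have : (x + k) ^ (n + 1) = (x + k) ^ k * (x + k) ^ (n + 1 - k) := by
        rw [← pow_add]; congr 1; omega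
      rw [this]; ring
    · symm
      rw [Finset.sum_range_succ _ (n + 1)]
      rw [Finset.sum_eq_zero]
      · simp only [Nat.descFactorial_self, Nat.sub_self, pow_zero, mul_one, zero_add]
      · intro j hj
        have : n + 1 - j ≠ 0 := by have := Finset.mem_range.1 hj; omega
        rw [show x + (-((n + 1 : ℕ) : ℝ) - x) + (n + 1 : ℕ) = 0 by ring, zero_pow this, mul_zero]

theorem descFactorial_div_pow_le (n j : ℕ) (hn : 0 < n) (hj : j + 1 ≤ n) :
    (n.descFactorial (j + 1) : ℝ) / n ^ (j + 1) ≤ exp (-(j : ℝ) ^ 2 / (2 * n)) := by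
  have hn' : (0 : ℝ) < n := by exact_mod_cast hn
  induction j with
  | zero => simp [hn'.ne']
  | succ j ih =>
    have ih := ih (by omega)
    rw [Nat.descFactorial_succ, pow_succ]
    push_cast [show j + 1 ≤ n by omega]
    calc ((n : ℝ) - (j + 1)) * n.descFactorial (j + 1) / (n ^ (j + 1) * n)
        = (n.descFactorial (j + 1) / n ^ (j + 1)) * (1 - (j + 1) / n) := by field_simp
      _ ≤ exp (-(j : ℝ) ^ 2 / (2 * n)) * exp (-((j + 1) / n)) := by
          have h0 : (0 : ℝ) ≤ 1 - (j + 1) / n := by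
            rw [sub_nonneg, div_le_one hn']; exact_mod_cast (by omega : j + 1 ≤ n)
          refine mul_le_mul ih ?_ h0 (exp_pos _).le
          have := Real.add_one_le_exp (-(((j : ℝ) + 1) / n)); linarith
      _ ≤ _ := by
          rw [← exp_add, exp_le_exp]
          have : -(j : ℝ) ^ 2 / (2 * n) + -((j + 1) / n) - -((j : ℝ) + 1) ^ 2 / (2 * n)
            = -(1 / (2 * n)) := by field_simp; ring
          have : 0 ≤ 1 / (2 * (n : ℝ)) := by positivity
          linarith

theorem sum_choose_mul_pow_div_le (n : ℕ) (hn : 0 < n) :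
    ∑ k ∈ Finset.range (n + 1),
      (n.choose k : ℝ) * ((k / n : ℝ) ^ k * (1 - k / n : ℝ) ^ (n - k)) ≤ √(π * n / 2) + 2 := by
  have hn' : (0 : ℝ) < n := by exact_mod_cast hn
  have habel := sum_choose_mul_pow_mul_pow n 0 0
  simp only [zero_add] at habel
  have h1 : ∑ k ∈ Finset.range (n + 1),
      (n.choose k : ℝ) * ((k / n : ℝ) ^ k * (1 - k / n : ℝ) ^ (n - k)) =
      ∑ j ∈ Finset.range (n + 1), (n.descFactorial j : ℝ) / n ^ j := by
    have hL : ∑ k ∈ Finset.range (n + 1),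
        (n.choose k : ℝ) * ((k / n : ℝ) ^ k * (1 - k / n : ℝ) ^ (n - k)) =
        (∑ k ∈ Finset.range (n + 1),
          (n.choose k : ℝ) * (k : ℝ) ^ k * ((n : ℝ) - k) ^ (n - k)) / n ^ n := by
      rw [Finset.sum_div]
      refine Finset.sum_congr rfl fun k hk => ?_
      have hk' : k ≤ n := by simpa [Nat.lt_succ_iff] using hk
      rw [show (1 - k / n : ℝ) = (n - k) / n by field_simp, div_pow, div_pow]
      have : (n : ℝ) ^ n = n ^ k * n ^ (n - k) := by rw [← pow_add]; congr 1; omega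
      rw [this]; field_simp
    rw [hL, habel, Finset.sum_div]
    refine Finset.sum_congr rfl fun j hj => ?_
    have hj' : j ≤ n := by simpa [Nat.lt_succ_iff] using hj
    have : (n : ℝ) ^ n = n ^ j * n ^ (n - j) := by rw [← pow_add]; congr 1; omega
    rw [this]; field_simp
  rw [h1]
  obtain ⟨m, rfl⟩ : ∃ m, n = m + 1 := ⟨n - 1, by omega⟩
  rw [Finset.sum_range_succ' _ (m + 1), Finset.sum_range_succ' _ m]
  set N : ℝ := ((m + 1 : ℕ) : ℝ) with hN
  have hg : ∀ x : ℝ, -x ^ 2 / (2 * N) = -(1 / (2 * N)) * x ^ 2 := fun x => by ring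
  have h2 : ∑ j ∈ Finset.range m, ((m + 1).descFactorial (j + 1 + 1) : ℝ) / N ^ (j + 1 + 1) ≤
      √(π * N / 2) := by
    calc _ ≤ ∑ j ∈ Finset.range m, exp (-(1 / (2 * N)) * (0 + ((j + 1 : ℕ) : ℝ)) ^ 2) := by
          refine Finset.sum_le_sum fun j hj => ?_
          have hj := Finset.mem_range.1 hj
          refine (descFactorial_div_pow_le (m + 1) (j + 1) hn (by omega)).trans_eq ?_
          rw [hg, zero_add]
      _ ≤ ∫ x in (0 : ℝ)..(0 + m), exp (-(1 / (2 * N)) * x ^ 2) := by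
          refine AntitoneOn.sum_le_integral (f := fun x : ℝ => exp (-(1 / (2 * N)) * x ^ 2)) ?_
          intro x hx y hy hxy
          simp only [exp_le_exp]
          have : x ^ 2 ≤ y ^ 2 := pow_le_pow_left₀ hx.1 hxy 2
          have h0 : 0 ≤ 1 / (2 * N) := by positivity
          nlinarith
      _ ≤ ∫ x in Set.Ioi (0 : ℝ), exp (-(1 / (2 * N)) * x ^ 2) := by
          rw [intervalIntegral.integral_of_le (by positivity)]
          refine setIntegral_mono_set ?_ ?_ ?_
          · exact (integrable_exp_neg_mul_sq (by positivity)).integrableOn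
          · exact Filter.Eventually.of_forall fun x => (exp_pos _).le
          · exact (Set.Ioc_subset_Ioi_self).eventuallyLE
      _ = √(π * N / 2) := by
          rw [integral_gaussian_Ioi]
          rw [show π * N / 2 = (π / (1 / (2 * N))) / 2 ^ 2 by field_simp]
          rw [Real.sqrt_div' _ (by positivity : (0 : ℝ) ≤ 2 ^ 2), Real.sqrt_sq (by norm_num)]
  have h3 : ((m + 1).descFactorial (0 + 1) : ℝ) / N ^ (0 + 1) = 1 := by
    simp only [zero_add, Nat.descFactorial_one, pow_one]; exact div_self hn'.ne'
  have h4 : ((m + 1).descFactorial 0 : ℝ) / N ^ 0 = 1 := by simp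
  rw [h3, h4]
  linarith

theorem pow_mul_pow_le (n k : ℕ) (hn : 0 < n) (hk : k ≤ n) (t : ℝ) (h0 : 0 ≤ t) (h1 : t ≤ 1) :
    t ^ k * (1 - t) ^ (n - k) ≤ (k / n : ℝ) ^ k * (1 - k / n : ℝ) ^ (n - k) := by
  have hn' : (0 : ℝ) < n := by exact_mod_cast hn
  rcases Nat.eq_zero_or_pos k with rfl | hk0
  · simp only [pow_zero, one_mul, Nat.cast_zero, zero_div, sub_zero, one_pow]
    exact pow_le_one₀ (by linarith) (by linarith)
  rcases hk.eq_or_lt with rfl | hkn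
  · simp only [Nat.sub_self, pow_zero, mul_one]
    rw [div_self hn'.ne', one_pow]
    exact pow_le_one₀ h0 h1
  have hk0' : (0 : ℝ) < k := by exact_mod_cast hk0
  have hkn' : (k : ℝ) < n := by exact_mod_cast hkn
  set q : ℝ := k / n with hq
  have hq0 : 0 < q := by positivity
  have hq1 : 0 < 1 - q := by rw [sub_pos, hq, div_lt_one hn']; exact hkn'
  have ham := Real.geom_mean_le_arith_mean2_weighted hq0.le hq1.le
    (div_nonneg h0 hq0.le) (div_nonneg (sub_nonneg.2 h1) hq1.le) (by ring)
  have hone : q * (t / q) + (1 - q) * ((1 - t) / (1 - q)) = 1 := by field_simp; ring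
  rw [hone] at ham
  have hp := pow_le_one₀ (n := n) (by positivity) ham
  rw [mul_pow, ← Real.rpow_mul_natCast (by positivity), ← Real.rpow_mul_natCast (div_nonneg (sub_nonneg.2 h1) hq1.le)] at hp
  have e1 : q * n = (k : ℕ) := by rw [hq]; field_simp
  have e2 : (1 - q) * n = ((n - k : ℕ) : ℝ) := by
    rw [Nat.cast_sub hk, sub_mul, e1]; ring
  rw [e1, e2, Real.rpow_natCast, Real.rpow_natCast, div_pow t, div_pow (1 - t), div_mul_div_comm,
    div_le_one (by positivity)] at hp
  exact hp

/-- The multilinear envelope of the exponentiated binary relative entropy: on a vertex of the cube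
with `k` ones it equals the ratio of the maximal binomial likelihood to the one at `p`. -/
noncomputable def likelihoodEnvelope {n : ℕ} (p : ℝ) (x : Fin n → ℝ) : ℝ :=
  ∑ t ∈ (Finset.univ : Finset (Fin n)).powerset,
    ((∏ i ∈ t, x i) * ∏ i ∈ Finset.univ \ t, (1 - x i)) *
      ((t.card / n : ℝ) ^ t.card * (1 - t.card / n : ℝ) ^ (n - t.card) /
        (p ^ t.card * (1 - p) ^ (n - t.card)))

theorem one_sub_mul_exp_pos {p γ : ℝ} (hp : p < 1) (hp0 : 0 < p) :
    0 < 1 - p * (1 - exp (-γ)) := by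
  nlinarith [mul_pos hp0 (exp_pos (-γ))]

theorem maxLikelihood_nonneg {n k : ℕ} (hk : k ≤ n) :
    0 ≤ (k / n : ℝ) ^ k * (1 - k / n : ℝ) ^ (n - k) := by
  have : (k / n : ℝ) ≤ 1 := div_le_one_of_le₀ (by exact_mod_cast hk) (by positivity)
  have : 0 ≤ (1 - k / n : ℝ) := by linarith
  positivity

theorem card_le_of_fin {n : ℕ} (t : Finset (Fin n)) : t.card ≤ n := by
  simpa using Finset.card_le_univ t

theorem likelihoodEnvelope_nonneg {n : ℕ} {p : ℝ} (hp0 : 0 < p) (hp1 : p < 1) {x : Fin n → ℝ}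
    (hx : ∀ i, x i ∈ Set.Icc (0 : ℝ) 1) : 0 ≤ likelihoodEnvelope p x := by
  refine Finset.sum_nonneg fun t _ => mul_nonneg (mul_nonneg ?_ ?_) (div_nonneg ?_ ?_)
  · exact Finset.prod_nonneg fun i _ => (hx i).1
  · exact Finset.prod_nonneg fun i _ => sub_nonneg.2 (hx i).2
  · exact maxLikelihood_nonneg (card_le_of_fin t)
  · have : 0 < 1 - p := by linarith
    positivity

theorem exp_mul_le_of_mem_Icc (γ : ℝ) {x : ℝ} (hx : x ∈ Set.Icc (0 : ℝ) 1) :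
    exp (-γ * x) ≤ x * exp (-γ) + (1 - x) := by
  have h := convexOn_exp.2 (Set.mem_univ (-γ)) (Set.mem_univ 0) hx.1 (sub_nonneg.2 hx.2)
    (by ring)
  simpa [mul_comm] using h

theorem exp_div_pow_le_likelihoodEnvelope {n : ℕ} (hn : 0 < n) {p : ℝ} (hp0 : 0 < p) (hp1 : p < 1)
    (γ : ℝ) {x : Fin n → ℝ} (hx : ∀ i, x i ∈ Set.Icc (0 : ℝ) 1) :
    exp (-γ * ∑ i, x i) / (1 - p * (1 - exp (-γ))) ^ n ≤ likelihoodEnvelope p x := by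
  set D := 1 - p * (1 - exp (-γ)) with hD
  have hDpos : 0 < D := one_sub_mul_exp_pos hp1 hp0
  have h1p : 0 < 1 - p := by linarith
  have hprod : exp (-γ * ∑ i, x i) ≤ ∏ i, (x i * exp (-γ) + (1 - x i)) := by
    rw [Finset.mul_sum, exp_sum]
    exact Finset.prod_le_prod (fun i _ => (exp_pos _).le)
      fun i _ => exp_mul_le_of_mem_Icc γ (hx i)
  rw [Finset.prod_add] at hprod
  refine (div_le_div_of_nonneg_right hprod (by positivity)).trans ?_
  rw [Finset.sum_div]
  refine Finset.sum_le_sum fun t _ => ?_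
  rw [Finset.prod_mul_distrib, Finset.prod_const]
  set k := t.card with hk
  have hkn : k ≤ n := card_le_of_fin t
  have hbase : 0 ≤ (∏ i ∈ t, x i) * ∏ i ∈ Finset.univ \ t, (1 - x i) :=
    mul_nonneg (Finset.prod_nonneg fun i _ => (hx i).1)
      (Finset.prod_nonneg fun i _ => sub_nonneg.2 (hx i).2)
  have hpD : 0 ≤ p * exp (-γ) / D := by positivity
  have hqD : 1 - p * exp (-γ) / D = (1 - p) / D := by
    rw [eq_div_iff hDpos.ne', sub_mul, div_mul_cancel₀ _ hDpos.ne', hD]; ring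
  have hle1 : p * exp (-γ) / D ≤ 1 := by
    have : 0 ≤ (1 - p) / D := by positivity
    linarith
  have hmax := pow_mul_pow_le n k hn hkn _ hpD hle1
  rw [hqD, div_pow, div_pow, div_mul_div_comm, ← pow_add, Nat.add_sub_cancel' hkn, mul_pow] at hmax
  have hratio : exp (-γ) ^ k / D ^ n ≤
      (k / n : ℝ) ^ k * (1 - k / n : ℝ) ^ (n - k) / (p ^ k * (1 - p) ^ (n - k)) := by
    rw [le_div_iff₀ (by positivity)]
    refine le_trans (le_of_eq ?_) hmax
    ring
  calc _ = ((∏ i ∈ t, x i) * ∏ i ∈ Finset.univ \ t, (1 - x i)) * (exp (-γ) ^ k / D ^ n) := by ring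
    _ ≤ _ := mul_le_mul_of_nonneg_left hratio hbase

section Product

variable {Ω : Type*} [MeasurableSpace Ω]

theorem measurable_likelihoodEnvelope {S : Type*} [MeasurableSpace S] {n : ℕ} {p : S → ℝ}
    {x : S → Fin n → ℝ} (hp : Measurable p) (hx : ∀ i, Measurable fun s => x s i) :
    Measurable fun s => likelihoodEnvelope (p s) (x s) := by
  unfold likelihoodEnvelope
  fun_prop

theorem integral_likelihoodEnvelope {n : ℕ} (P : Measure Ω) [IsProbabilityMeasure P] {h : Ω → ℝ}
    (hh : Measurable h) (hh01 : ∀ ω, h ω ∈ Set.Icc (0 : ℝ) 1)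
    (hp0 : 0 < ∫ ω, h ω ∂P) (hp1 : ∫ ω, h ω ∂P < 1) :
    Integrable (fun ωs : Fin n → Ω => likelihoodEnvelope (∫ ω, h ω ∂P) fun i => h (ωs i))
      (Measure.pi fun _ => P) ∧
    ∫ ωs : Fin n → Ω, likelihoodEnvelope (∫ ω, h ω ∂P) (fun i => h (ωs i))
      ∂(Measure.pi fun _ => P) =
      ∑ k ∈ Finset.range (n + 1),
        (n.choose k : ℝ) * ((k / n : ℝ) ^ k * (1 - k / n : ℝ) ^ (n - k)) := by
  set p := ∫ ω, h ω ∂P with hp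
  have h1p : 0 < 1 - p := by linarith
  have hinteg : Integrable h P := Integrable.of_mem_Icc 0 1 hh.aemeasurable
    (Filter.Eventually.of_forall hh01)
  have hterm : ∀ (t : Finset (Fin n)) (ωs : Fin n → Ω),
      (∏ i ∈ t, h (ωs i)) * ∏ i ∈ Finset.univ \ t, (1 - h (ωs i)) =
        ∏ i, (if i ∈ t then h else fun ω => 1 - h ω) (ωs i) := by
    intro t ωs
    rw [← Finset.prod_sdiff (Finset.subset_univ t), mul_comm]
    congr 1
    · exact Finset.prod_congr rfl fun i hi => by rw [if_neg (Finset.mem_sdiff.1 hi).2]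
    · exact Finset.prod_congr rfl fun i hi => by rw [if_pos hi]
  have hprodint : ∀ t : Finset (Fin n), Integrable (fun ωs : Fin n → Ω =>
      (∏ i ∈ t, h (ωs i)) * ∏ i ∈ Finset.univ \ t, (1 - h (ωs i))) (Measure.pi fun _ => P) := by
    intro t
    simp_rw [hterm]
    refine Integrable.fintype_prod fun i => ?_
    split_ifs
    · exact hinteg
    · exact (integrable_const 1).sub hinteg
  have hval : ∀ t : Finset (Fin n), ∫ ωs : Fin n → Ω,
      (∏ i ∈ t, h (ωs i)) * ∏ i ∈ Finset.univ \ t, (1 - h (ωs i)) ∂(Measure.pi fun _ => P) =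
        p ^ t.card * (1 - p) ^ (n - t.card) := by
    intro t
    simp_rw [hterm]
    rw [integral_fintype_prod_eq_prod (fun i => if i ∈ t then h else fun ω => 1 - h ω),
      ← Finset.prod_sdiff (Finset.subset_univ t), mul_comm]
    congr 1
    · rw [Finset.prod_congr rfl (g := fun _ => p), Finset.prod_const]
      intro i hi
      rw [if_pos hi]
    · rw [Finset.prod_congr rfl (g := fun _ => 1 - p), Finset.prod_const,
        Finset.card_sdiff_of_subset (Finset.subset_univ t), Finset.card_univ, Fintype.card_fin]
      intro i hi
      rw [if_neg (Finset.mem_sdiff.1 hi).2, integral_sub (integrable_const 1) hinteg]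
      simp [hp]
  refine ⟨integrable_finsetSum _ fun t _ => (hprodint t).mul_const _, ?_⟩
  unfold likelihoodEnvelope
  rw [integral_finsetSum _ fun t _ => (hprodint t).mul_const _]
  rw [Finset.sum_congr rfl (g := fun t : Finset (Fin n) =>
    (t.card / n : ℝ) ^ t.card * (1 - t.card / n : ℝ) ^ (n - t.card))]
  · rw [Finset.sum_powerset_apply_card
      (fun k : ℕ => (k / n : ℝ) ^ k * (1 - k / n : ℝ) ^ (n - k))]
    simp
  · intro t _
    rw [integral_mul_const, hval, mul_div_cancel₀ _ (by positivity)]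

end Product

theorem integral_le_integral_llr_add_log_s13 {Θ : Type*} [MeasurableSpace Θ] {Q Pri : Measure Θ}
    [IsProbabilityMeasure Q] [IsProbabilityMeasure Pri] (hac : Q ≪ Pri)
    (hllr : Integrable (llr Q Pri) Q) {g : Θ → ℝ} (hgQ : Integrable g Q)
    (hg : Integrable (fun θ => exp (g θ)) Pri) :
    ∫ θ, g θ ∂Q ≤ ∫ θ, llr Q Pri θ ∂Q + log (∫ θ, exp (g θ) ∂Pri) := by
  have := isProbabilityMeasure_tilted hg
  have h := InformationTheory.integral_llr_add_sub_measure_univ_nonneg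
    (hac.trans (absolutelyContinuous_tilted hg)) (integrable_llr_tilted_right hac hgQ hllr hg)
  rw [integral_llr_tilted_right hac hgQ hg hllr] at h
  simp only [probReal_univ] at h
  linarith

theorem pacBayes_catoni_uniform {Ω Θ : Type*} [MeasurableSpace Ω] [MeasurableSpace Θ]
    (P : Measure Ω) [IsProbabilityMeasure P] (Pri : Measure Θ) [IsProbabilityMeasure Pri]
    (l : Θ → Ω → ℝ) (hl : Measurable fun q : Θ × Ω => l q.1 q.2)
    (hl01 : ∀ θ ω, l θ ω ∈ Set.Icc (0 : ℝ) 1)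
    (hL0 : ∀ θ, 0 < ∫ ω, l θ ω ∂P) (hL1 : ∀ θ, ∫ ω, l θ ω ∂P < 1)
    (n : ℕ) (hn : 0 < n) (δ ξ : ℝ) (hδ : δ ∈ Set.Ioo (0 : ℝ) 1)
    (hξ : √(π * n / 2) + 2 ≤ ξ) :
    ENNReal.ofReal (1 - δ) ≤ (Measure.pi fun _ : Fin n => P)
      {ωs | ∀ Q : Measure Θ, IsProbabilityMeasure Q → Q ≪ Pri → Integrable (llr Q Pri) Q →
        ∀ γ : ℝ, 0 < γ →
        ∫ θ, (∫ ω, l θ ω ∂P) ∂Q ≤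
          (1 - exp (-((∫ θ, llr Q Pri θ ∂Q + log (ξ / δ)) / n) -
            γ * ∫ θ, (n : ℝ)⁻¹ * ∑ i, l θ (ωs i) ∂Q)) / (1 - exp (-γ))} := by
  set L : Θ → ℝ := fun θ => ∫ ω, l θ ω ∂P with hLdef
  have hn' : (0 : ℝ) < n := by exact_mod_cast hn
  have hLm : Measurable L := (hl.stronglyMeasurable.integral_prod_right').measurable
  have hlθ : ∀ θ, Measurable (l θ) := fun θ => hl.comp (measurable_const.prodMk measurable_id)
  have hlω : ∀ ω, Measurable fun θ => l θ ω := fun ω =>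
    hl.comp (measurable_id.prodMk measurable_const)
  have hξ0 : 0 < ξ := lt_of_lt_of_le (by positivity) hξ
  have hEm : Measurable fun q : (Fin n → Ω) × Θ =>
      likelihoodEnvelope (L q.2) fun i => l q.2 (q.1 i) :=
    measurable_likelihoodEnvelope (hLm.comp measurable_snd) fun i =>
      hl.comp (measurable_snd.prodMk ((measurable_pi_apply i).comp measurable_fst))
  set W : (Fin n → Ω) → ℝ≥0∞ := fun ωs =>
    ∫⁻ θ, ENNReal.ofReal (likelihoodEnvelope (L θ) fun i => l θ (ωs i)) ∂Pri with hW
  have hWm : Measurable W := hEm.ennreal_ofReal.lintegral_prod_right'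
  have hWint : ∫⁻ ωs, W ωs ∂(Measure.pi fun _ => P) ≤ ENNReal.ofReal ξ := by
    rw [hW, lintegral_lintegral_swap hEm.ennreal_ofReal.aemeasurable]
    calc _ ≤ ∫⁻ _ : Θ, ENNReal.ofReal ξ ∂Pri := by
          refine lintegral_mono fun θ => ?_
          obtain ⟨h1, h2⟩ := integral_likelihoodEnvelope (n := n) P (hlθ θ) (hl01 θ) (hL0 θ) (hL1 θ)
          rw [← ofReal_integral_eq_lintegral_ofReal h1 (Filter.Eventually.of_forall fun ωs =>
            likelihoodEnvelope_nonneg (hL0 θ) (hL1 θ) fun i => hl01 θ _), h2]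
          exact ENNReal.ofReal_le_ofReal ((sum_choose_mul_pow_div_le n hn).trans hξ)
      _ = _ := by simp
  have hmarkov : (Measure.pi fun _ : Fin n => P) {ωs | ENNReal.ofReal (ξ / δ) ≤ W ωs} ≤
      ENNReal.ofReal δ := by
    refine (meas_ge_le_lintegral_div hWm.aemeasurable ?_ ENNReal.ofReal_ne_top).trans ?_
    · simpa using div_pos hξ0 hδ.1
    · refine (ENNReal.div_le_div_right hWint _).trans_eq ?_
      rw [← ENNReal.ofReal_div_of_pos (div_pos hξ0 hδ.1)]
      congr 1
      have := hδ.1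
      field_simp
  have hgood : ENNReal.ofReal (1 - δ) ≤
      (Measure.pi fun _ : Fin n => P) {ωs | ENNReal.ofReal (ξ / δ) ≤ W ωs}ᶜ := by
    rw [prob_compl_eq_one_sub (measurableSet_le measurable_const hWm),
      ENNReal.ofReal_sub _ hδ.1.le, ENNReal.ofReal_one]
    exact tsub_le_tsub_left hmarkov 1
  refine hgood.trans (measure_mono ?_)
  intro ωs hωs Q hQ hac hllr γ hγ
  have hWle : W ωs ≤ ENNReal.ofReal (ξ / δ) := (not_le.1 (show ¬ _ ≤ W ωs from hωs)).le
  have heγ : exp (-γ) < 1 := exp_lt_one_iff.2 (by linarith)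
  have hD : ∀ θ, exp (-γ) ≤ 1 - L θ * (1 - exp (-γ)) := fun θ => by nlinarith [hL1 θ]
  have hD1 : ∀ θ, 1 - L θ * (1 - exp (-γ)) ≤ 1 := fun θ => by nlinarith [hL0 θ]
  have hDpos : ∀ θ, 0 < 1 - L θ * (1 - exp (-γ)) := fun θ => (exp_pos _).trans_le (hD θ)
  have hDm : Measurable fun θ => 1 - L θ * (1 - exp (-γ)) := by fun_prop
  have hLint : Integrable L Q := Integrable.of_mem_Icc 0 1 hLm.aemeasurable
    (Filter.Eventually.of_forall fun θ => ⟨(hL0 θ).le, (hL1 θ).le⟩)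
  have hDint : Integrable (fun θ => 1 - L θ * (1 - exp (-γ))) Q :=
    (integrable_const 1).sub (hLint.mul_const _)
  have hlogint : Integrable (fun θ => log (1 - L θ * (1 - exp (-γ)))) Q := by
    refine Integrable.of_mem_Icc (-γ) 0 (measurable_log.comp hDm).aemeasurable
      (Filter.Eventually.of_forall fun θ => ⟨?_, ?_⟩)
    · rw [le_log_iff_exp_le (hDpos θ)]; exact hD θ
    · exact log_nonpos (hDpos θ).le (hD1 θ)
  have hsumm : Measurable fun θ => ∑ i, l θ (ωs i) :=
    Finset.measurable_fun_sum _ fun i _ => hlω (ωs i)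
  have hsum0 : ∀ θ, 0 ≤ ∑ i, l θ (ωs i) := fun θ => Finset.sum_nonneg fun i _ => (hl01 θ _).1
  have hsumint : Integrable (fun θ => ∑ i, l θ (ωs i)) Q :=
    integrable_finsetSum _ fun i _ => Integrable.of_mem_Icc 0 1 (hlω _).aemeasurable
      (Filter.Eventually.of_forall fun θ => hl01 θ _)
  set g : Θ → ℝ := fun θ =>
    -(n * log (1 - L θ * (1 - exp (-γ)))) - γ * ∑ i, l θ (ωs i) with hg
  have hgm : Measurable g := by
    have := measurable_log.comp hDm
    exact ((this.const_mul _).neg).sub (hsumm.const_mul _)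
  have hgint : Integrable g Q := (hlogint.const_mul _).neg.sub (hsumint.const_mul _)
  have hexpg : ∀ θ, exp (g θ) =
      exp (-γ * ∑ i, l θ (ωs i)) / (1 - L θ * (1 - exp (-γ))) ^ n := by
    intro θ
    rw [hg]
    simp only
    rw [sub_eq_add_neg, exp_add, exp_neg (n * _), ← log_pow, exp_log (pow_pos (hDpos θ) n),
      neg_mul]
    ring
  have hexpint : Integrable (fun θ => exp (g θ)) Pri := by
    refine Integrable.of_mem_Icc 0 (exp (n * γ)) hgm.exp.aemeasurable
      (Filter.Eventually.of_forall fun θ => ⟨(exp_pos _).le, exp_le_exp.2 ?_⟩)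
    have h1 : -γ ≤ log (1 - L θ * (1 - exp (-γ))) := by
      rw [le_log_iff_exp_le (hDpos θ)]; exact hD θ
    have h2 := mul_nonneg hγ.le (hsum0 θ)
    simp only [hg]
    nlinarith
  have hexple : ∫ θ, exp (g θ) ∂Pri ≤ ξ / δ := by
    rw [← ENNReal.ofReal_le_ofReal_iff (div_pos hξ0 hδ.1).le,
      ofReal_integral_eq_lintegral_ofReal hexpint
        (Filter.Eventually.of_forall fun θ => (exp_pos _).le)]
    refine le_trans (lintegral_mono fun θ => ENNReal.ofReal_le_ofReal ?_) hWle
    rw [hexpg]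
    exact exp_div_pow_le_likelihoodEnvelope hn (hL0 θ) (hL1 θ) γ fun i => hl01 θ _
  have hDV := integral_le_integral_llr_add_log_s13 hac hllr hgint hexpint
  have hlogle : log (∫ θ, exp (g θ) ∂Pri) ≤ log (ξ / δ) :=
    log_le_log (integral_exp_pos hexpint) hexple
  have hgval : ∫ θ, g θ ∂Q = -(n * ∫ θ, log (1 - L θ * (1 - exp (-γ))) ∂Q) -
      γ * ∫ θ, ∑ i, l θ (ωs i) ∂Q := by
    rw [hg, integral_sub (f := fun θ => -(n * log (1 - L θ * (1 - exp (-γ)))))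
      (hlogint.const_mul _).neg (hsumint.const_mul _), integral_neg,
      integral_const_mul, integral_const_mul]
  set m : ℝ := 1 - (∫ θ, L θ ∂Q) * (1 - exp (-γ)) with hm
  have hmeq : ∫ θ, (1 - L θ * (1 - exp (-γ))) ∂Q = m := by
    rw [integral_sub (integrable_const 1) (hLint.mul_const _), integral_mul_const]
    simp [hm]
  have hmpos : 0 < m := by
    rw [← hmeq]
    refine (exp_pos (-γ)).trans_le ?_
    calc exp (-γ) = ∫ _ : Θ, exp (-γ) ∂Q := by simp
      _ ≤ _ := integral_mono (integrable_const _) hDint hD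
  have hjensen : ∫ θ, log (1 - L θ * (1 - exp (-γ))) ∂Q ≤ log m := by
    calc _ ≤ ∫ θ, ((1 - L θ * (1 - exp (-γ))) / m - 1 + log m) ∂Q := by
          refine integral_mono hlogint (((hDint.div_const m).sub (integrable_const 1)).add
            (integrable_const _)) fun θ => ?_
          have h := log_le_sub_one_of_pos (div_pos (hDpos θ) hmpos)
          rw [log_div (hDpos θ).ne' hmpos.ne'] at h
          simp only
          linarith
      _ = log m := by
          rw [integral_add (f := fun θ => (1 - L θ * (1 - exp (-γ))) / m - 1)
              ((hDint.div_const m).sub (integrable_const 1)) (integrable_const _),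
            integral_sub (hDint.div_const m) (integrable_const 1), integral_div, hmeq,
            div_self hmpos.ne']
          simp
  rw [le_div_iff₀ (by linarith)]
  suffices exp (-((∫ θ, llr Q Pri θ ∂Q + log (ξ / δ)) / n) -
      γ * ∫ θ, (n : ℝ)⁻¹ * ∑ i, l θ (ωs i) ∂Q) ≤ m by
    rw [hm] at this
    linarith
  rw [← le_log_iff_exp_le hmpos, integral_const_mul]
  have hkey : -(n * log m) - γ * ∫ θ, ∑ i, l θ (ωs i) ∂Q ≤
      ∫ θ, llr Q Pri θ ∂Q + log (ξ / δ) := by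
    nlinarith [mul_le_mul_of_nonneg_left hjensen hn'.le]
  have hdiv := div_le_div_of_nonneg_right hkey hn'.le
  have hsplit : (-(n * log m) - γ * ∫ θ, ∑ i, l θ (ωs i) ∂Q) / n =
      -log m - γ * ((n : ℝ)⁻¹ * ∫ θ, ∑ i, l θ (ωs i) ∂Q) := by
    field_simp
  linarith

section Identification

variable {Ω 𝒳 : Type*} [MeasurableSpace Ω] [StandardBorelSpace Ω] [MeasurableSpace 𝒳]
  {P : Measure Ω} [IsProbabilityMeasure P] {X : Ω → 𝒳} {hX : Measurable X}
  {A : Ω → ℤ} {a : ℤ} {p : 𝒳 → ℝ}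

theorem setIntegral_eq_integral_propensity_mul {β : Type*} [MeasurableSpace β] {V : Ω → β}
    (hV : Measurable V) (hA : Measurable A)
    (hind : CondIndepFun (MeasurableSpace.comap X inferInstance) hX.comap_le V A P)
    (hp : Measurable p) (hp0 : ∀ x, 0 ≤ p x)
    (hpver : (P[(fun ω => if A ω = a then (1 : ℝ) else 0) |
      MeasurableSpace.comap X inferInstance]) =ᵐ[P] fun ω => p (X ω))
    {F : β × 𝒳 → ℝ} (hF : Measurable F) :
    ∫ ω in {ω | A ω = a}, F (V ω, X ω) ∂P = ∫ ω, p (X ω) * F (V ω, X ω) ∂P := by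
  have hAa : MeasurableSet {ω | A ω = a} := hA (measurableSet_singleton a)
  have hVX : Measurable fun ω => (V ω, X ω) := hV.prodMk hX
  have hpX : Measurable fun ω => ENNReal.ofReal (p (X ω)) := (hp.comp hX).ennreal_ofReal
  have hpint : Integrable (fun ω => p (X ω)) P := integrable_condExp.congr hpver
  have hmeas : (P.restrict {ω | A ω = a}).map (fun ω => (V ω, X ω)) =
      (P.withDensity fun ω => ENNReal.ofReal (p (X ω))).map fun ω => (V ω, X ω) := by
    refine Measure.ext_prod fun {s t} hs ht => ?_
    rw [Measure.map_apply hVX (hs.prod ht), Measure.map_apply hVX (hs.prod ht),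
      Measure.restrict_apply (hVX (hs.prod ht)), withDensity_apply _ (hVX (hs.prod ht)),
      ← ofReal_integral_eq_lintegral_ofReal hpint.integrableOn
        (Filter.Eventually.of_forall fun ω => hp0 _), ← ofReal_measureReal]
    congr 1
    have hXt : MeasurableSet[MeasurableSpace.comap X inferInstance] (X ⁻¹' t) := ⟨t, ht, rfl⟩
    have hVs : MeasurableSet (V ⁻¹' s) := hV hs
    have hcond := (condIndepFun_iff_condExp_inter_preimage_eq_mul hV hA).1 hind s {a} hs
      (measurableSet_singleton a)
    have hindA : ((A ⁻¹' {a}).indicator fun _ => (1 : ℝ)) =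
        fun ω => if A ω = a then (1 : ℝ) else 0 := by
      ext ω
      by_cases h : A ω = a <;> simp [h]
    rw [hindA] at hcond
    have hindint : Integrable ((V ⁻¹' s).indicator fun _ => (1 : ℝ)) P :=
      (integrable_const 1).indicator hVs
    have hmulint : Integrable (((V ⁻¹' s).indicator fun _ => (1 : ℝ)) * fun ω => p (X ω)) P := by
      refine (hpint.indicator hVs).congr (Filter.Eventually.of_forall fun ω => ?_)
      by_cases h : V ω ∈ s <;> simp [h]
    have hpull := condExp_mul_of_stronglyMeasurable_right (m := MeasurableSpace.comap X inferInstance)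
      (hp.comp (comap_measurable X)).stronglyMeasurable hmulint hindint
    calc P.real ((fun ω => (V ω, X ω)) ⁻¹' s ×ˢ t ∩ {ω | A ω = a})
        = ∫ ω in X ⁻¹' t, (V ⁻¹' s ∩ A ⁻¹' {a}).indicator (fun _ => (1 : ℝ)) ω ∂P := by
          rw [setIntegral_indicator (hVs.inter (hA (measurableSet_singleton a))),
            setIntegral_const, smul_eq_mul, mul_one]
          congr 1
          ext ω
          simp only [Set.mem_inter_iff, Set.mem_preimage, Set.mem_prod, Set.mem_singleton_iff,
            Set.mem_ofPred_eq]
          tauto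
      _ = ∫ ω in X ⁻¹' t, (P[(V ⁻¹' s ∩ A ⁻¹' {a}).indicator (fun _ => (1 : ℝ)) |
            MeasurableSpace.comap X inferInstance]) ω ∂P := by
          rw [setIntegral_condExp hX.comap_le _ hXt]
          exact (integrable_const 1).indicator (hVs.inter (hA (measurableSet_singleton a)))
      _ = ∫ ω in X ⁻¹' t, (P[((V ⁻¹' s).indicator fun _ => (1 : ℝ)) * (fun ω => p (X ω)) |
            MeasurableSpace.comap X inferInstance]) ω ∂P := by
          refine setIntegral_congr_ae (hX ht) ?_
          filter_upwards [hcond, hpver, hpull] with ω h1 h2 h3 _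
          rw [h1, h2]
          exact h3.symm
      _ = ∫ ω in X ⁻¹' t, (((V ⁻¹' s).indicator fun _ => (1 : ℝ)) * fun ω => p (X ω)) ω ∂P :=
          setIntegral_condExp hX.comap_le hmulint hXt
      _ = ∫ ω in X ⁻¹' t, (V ⁻¹' s).indicator (fun ω => p (X ω)) ω ∂P := by
          congr 1
          ext ω
          by_cases h : V ω ∈ s <;> simp [h]
      _ = ∫ ω in (fun ω => (V ω, X ω)) ⁻¹' s ×ˢ t, p (X ω) ∂P := by
          rw [setIntegral_indicator hVs]
          congr 2
          ext ω
          simp [and_comm]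
  rw [← integral_map hVX.aemeasurable hF.aestronglyMeasurable (μ := P.restrict _), hmeas,
    integral_map hVX.aemeasurable hF.aestronglyMeasurable,
    integral_withDensity_eq_integral_toReal_smul hpX
      (Filter.Eventually.of_forall fun ω => ENNReal.ofReal_lt_top)]
  simp [ENNReal.toReal_ofReal (hp0 _)]

end Identification

section Score

variable {Ω 𝒳 𝒜 : Type*} {X : Ω → 𝒳} {A : Ω → ℤ} {pr : ℤ → 𝒳 → ℝ}
  {ν : ℤ → 𝒳 → 𝒜 → ℝ} {ε : ℝ}

theorem Rlow_mem_Icc {R : Ω → ℝ} {U : 𝒳 → ℤ → ℝ → ℝ} (hR01 : ∀ ω, R ω ∈ Set.Icc (0 : ℝ) 1)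
    (hU01 : ∀ x a r, U x a r ∈ Set.Icc (0 : ℝ) 1) (ω : Ω) :
    Rlow X A R U ω ∈ Set.Icc (0 : ℝ) 1 :=
  ⟨le_max_right _ _, max_le (by linarith [(hR01 ω).2, (hU01 (X ω) (A ω) (R ω)).1]) zero_le_one⟩

theorem Gam_mem_Icc (hε : ε ∈ Set.Ioc (0 : ℝ) (1 / 2)) {a : ℤ} (hpr : ∀ x, ε ≤ pr a x)
    (hν01 : ∀ a x α, ν a x α ∈ Set.Icc (0 : ℝ) 1) {Rl : Ω → ℝ}
    (hRl : ∀ ω, Rl ω ∈ Set.Icc (0 : ℝ) 1) (α : 𝒜) (ω : Ω) :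
    Gam X A pr ν Rl a α ω ∈ Set.Icc (1 - ε⁻¹) ε⁻¹ := by
  obtain ⟨hν0, hν1⟩ := hν01 a (X ω) α
  obtain ⟨hr0, hr1⟩ := hRl ω
  have hε2 : 2 ≤ ε⁻¹ := by
    rw [le_inv_comm₀ (by norm_num) hε.1]; linarith [hε.2]
  unfold Gam
  split_ifs with h
  · have hi : (pr a (X ω))⁻¹ ≤ ε⁻¹ := inv_anti₀ hε.1 (hpr _)
    have hi0 : 0 < (pr a (X ω))⁻¹ := inv_pos.2 (hε.1.trans_le (hpr _))
    rw [one_div]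
    set w := (pr a (X ω))⁻¹
    rcases le_total w 1 with hw | hw
    · constructor <;> nlinarith
    · constructor <;> nlinarith
  · simp only [zero_div, zero_mul, add_zero]
    exact ⟨by linarith, by linarith⟩

theorem Vhat_mem_Icc (hε : ε ∈ Set.Ioc (0 : ℝ) (1 / 2))
    (hprε : ∀ a ∈ ({1, -1} : Set ℤ), ∀ x, ε ≤ pr a x)
    (hν01 : ∀ a x α, ν a x α ∈ Set.Icc (0 : ℝ) 1) {Rl : Ω → ℝ}
    (hRl : ∀ ω, Rl ω ∈ Set.Icc (0 : ℝ) 1) {ℬ : Type*} {f : 𝒳 → ℬ → ℝ} {n : ℕ} (hn : 0 < n) (θ : ℬ × 𝒜) (ωs : Fin n → Ω) :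
    Vhat X A pr ν Rl f n θ ωs ∈ Set.Icc (1 - ε⁻¹) ε⁻¹ := by
  have hn' : (0 : ℝ) < n := by exact_mod_cast hn
  have hG : ∀ ω, Gam X A pr ν Rl (if 0 ≤ f (X ω) θ.1 then 1 else -1) θ.2 ω ∈
      Set.Icc (1 - ε⁻¹) ε⁻¹ := fun ω =>
    Gam_mem_Icc hε (hprε _ (by split_ifs <;> simp)) hν01 hRl _ ω
  unfold Vhat
  rw [Set.mem_Icc, le_inv_mul_iff₀ hn', inv_mul_le_iff₀ hn']
  constructor
  · simpa using Finset.card_nsmul_le_sum Finset.univ _ _ fun i _ => (hG (ωs i)).1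
  · simpa using Finset.sum_le_card_nsmul Finset.univ _ _ fun i _ => (hG (ωs i)).2

theorem integral_mul_Gam_mem [MeasurableSpace Ω] [StandardBorelSpace Ω] [MeasurableSpace 𝒳]
    [MeasurableSpace 𝒜] {P : Measure Ω} [IsProbabilityMeasure P] {hX : Measurable X}
    (hA : Measurable A) {a : ℤ} {Y : Ω → ℝ} (hY : Measurable Y)
    (hY01 : ∀ ω, Y ω ∈ Set.Icc (0 : ℝ) 1)
    (hind : CondIndepFun (MeasurableSpace.comap X inferInstance) hX.comap_le Y A P)
    (hpr : Measurable (pr a)) (hε : 0 < ε) (hprε : ∀ x, ε ≤ pr a x)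
    (hprver : (P[(fun ω => if A ω = a then (1 : ℝ) else 0) |
      MeasurableSpace.comap X inferInstance]) =ᵐ[P] fun ω => pr a (X ω))
    (hν : Measurable fun q : 𝒳 × 𝒜 => ν a q.1 q.2)
    (hν01 : ∀ x α, ν a x α ∈ Set.Icc (0 : ℝ) 1) {Rl : Ω → ℝ} (hRlm : Measurable Rl)
    (hRl : ∀ ω, Rl ω ∈ Set.Icc (0 : ℝ) 1) (hle : ∀ᵐ ω ∂P, A ω = a → Rl ω ≤ Y ω)
    {g : 𝒳 → ℝ} (hg : Measurable g) (hg01 : ∀ x, g x ∈ Set.Icc (0 : ℝ) 1) (α : 𝒜) :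
    ∫ ω, g (X ω) * Gam X A pr ν Rl a α ω ∂P ∈
      Set.Icc 0 (∫ ω, g (X ω) * Y ω ∂P) := by
  have hAa : MeasurableSet {ω | A ω = a} := hA (measurableSet_singleton a)
  have hpos : ∀ x, 0 < pr a x := fun x => hε.trans_le (hprε x)
  have hνα : Measurable fun x => ν a x α := hν.comp (measurable_id.prodMk measurable_const)
  have hwm : Measurable fun x => g x / pr a x := hg.div hpr
  have hw : ∀ x, g x / pr a x ∈ Set.Icc 0 ε⁻¹ := fun x => by
    refine ⟨div_nonneg (hg01 x).1 (hpos x).le, ?_⟩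
    rw [div_eq_mul_inv]
    calc g x * (pr a x)⁻¹ ≤ 1 * ε⁻¹ :=
          mul_le_mul (hg01 x).2 (inv_anti₀ hε (hprε x)) (inv_pos.2 (hpos x)).le zero_le_one
      _ = ε⁻¹ := one_mul _
  have hbdd : ∀ {h : Ω → ℝ}, Measurable h → (∀ ω, h ω ∈ Set.Icc (0 : ℝ) 1) →
      Integrable (fun ω => g (X ω) / pr a (X ω) * h ω) P := by
    intro h hm h01
    refine Integrable.of_mem_Icc 0 ε⁻¹ ((hwm.comp hX).mul hm).aemeasurable
      (Filter.Eventually.of_forall fun ω => ⟨mul_nonneg (hw _).1 (h01 ω).1, ?_⟩)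
    exact (mul_le_of_le_one_right (hw _).1 (h01 ω).2).trans (hw _).2
  have hiR := hbdd hRlm hRl
  have hiY := hbdd hY hY01
  have hiν : Integrable (fun ω => g (X ω) / pr a (X ω) * ν a (X ω) α) P :=
    hbdd (hνα.comp hX) fun ω => hν01 (X ω) α
  have higν : Integrable (fun ω => g (X ω) * ν a (X ω) α) P := by
    refine Integrable.of_mem_Icc 0 1 ((hg.comp hX).mul (hνα.comp hX)).aemeasurable
      (Filter.Eventually.of_forall fun ω => ⟨mul_nonneg (hg01 _).1 (hν01 _ _).1, ?_⟩)
    exact mul_le_one₀ (hg01 _).2 (hν01 _ _).1 (hν01 _ _).2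
  have hcancel : ∀ ω (y : ℝ), pr a (X ω) * (g (X ω) / pr a (X ω) * y) = g (X ω) * y := by
    intro ω y
    have := (hpos (X ω)).ne'
    field_simp
  have hidν := setIntegral_eq_integral_propensity_mul (hX := hX) (a := a) hY hA hind hpr
    (fun x => (hpos x).le) hprver (F := fun q => g q.2 / pr a q.2 * ν a q.2 α)
    ((hwm.mul hνα).comp measurable_snd)
  have hidY := setIntegral_eq_integral_propensity_mul (hX := hX) (a := a) hY hA hind hpr
    (fun x => (hpos x).le) hprver (F := fun q => g q.2 / pr a q.2 * q.1)
    ((hwm.comp measurable_snd).mul measurable_fst)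
  simp only [hcancel] at hidν hidY
  have hval : ∫ ω, g (X ω) * Gam X A pr ν Rl a α ω ∂P =
      ∫ ω in {ω | A ω = a}, g (X ω) / pr a (X ω) * Rl ω ∂P := by
    have hpt : ∀ ω, g (X ω) * Gam X A pr ν Rl a α ω = g (X ω) * ν a (X ω) α +
        ({ω | A ω = a}.indicator (fun ω => g (X ω) / pr a (X ω) * Rl ω) -
          {ω | A ω = a}.indicator (fun ω => g (X ω) / pr a (X ω) * ν a (X ω) α)) ω := by
      intro ω
      unfold Gam
      by_cases h : A ω = a
      · simp [h]; ring
      · simp [h]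
    simp_rw [hpt]
    rw [integral_add higν ((hiR.indicator hAa).sub (hiν.indicator hAa)),
      integral_sub' (hiR.indicator hAa) (hiν.indicator hAa), integral_indicator hAa,
      integral_indicator hAa, hidν]
    ring
  rw [hval]
  constructor
  · exact integral_nonneg fun ω => mul_nonneg (hw _).1 (hRl ω).1
  · rw [← hidY]
    refine setIntegral_mono_on_ae hiR.integrableOn hiY.integrableOn hAa ?_
    filter_upwards [hle] with ω hω hωa
    exact mul_le_mul_of_nonneg_left (hω hωa) (hw _).1

end Score

section GibbsPosterior

variable {Θ : Type*} [MeasurableSpace Θ] {Q Pri : Measure Θ} [IsProbabilityMeasure Pri] {h : Θ → ℝ}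

theorem integrable_llr_tilted_self (hh : Integrable h (Pri.tilted h))
    (hexp : Integrable (fun θ => exp (h θ)) Pri) :
    Integrable (llr (Pri.tilted h) Pri) (Pri.tilted h) := by
  have := isProbabilityMeasure_tilted hexp
  refine (hh.sub (integrable_const (log (∫ θ, exp (h θ) ∂Pri)))).congr ?_
  exact ((tilted_absolutelyContinuous Pri h).ae_eq
    (log_rnDeriv_tilted_left_self hexp)).symm

theorem integral_sub_integral_llr_tilted (hh : Integrable h (Pri.tilted h))
    (hexp : Integrable (fun θ => exp (h θ)) Pri) :
    ∫ θ, h θ ∂(Pri.tilted h) - ∫ θ, llr (Pri.tilted h) Pri θ ∂(Pri.tilted h) =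
      log (∫ θ, exp (h θ) ∂Pri) := by
  have := isProbabilityMeasure_tilted hexp
  have hself := integral_llr_tilted_right (tilted_absolutelyContinuous Pri h) hh hexp
    (integrable_llr_tilted_self hh hexp)
  rw [integral_eq_zero_of_ae (llr_self _)] at hself
  linarith

theorem eq_tilted_of_integral_sub_integral_llr_eq [IsProbabilityMeasure Q] (hac : Q ≪ Pri)
    (hllr : Integrable (llr Q Pri) Q) (hh : Integrable h Q)
    (hexp : Integrable (fun θ => exp (h θ)) Pri)
    (heq : ∫ θ, h θ ∂Q - ∫ θ, llr Q Pri θ ∂Q = log (∫ θ, exp (h θ) ∂Pri)) :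
    Q = Pri.tilted h := by
  have := isProbabilityMeasure_tilted hexp
  rw [← InformationTheory.klDiv_eq_zero_iff,
    InformationTheory.klDiv_of_ac_of_integrable (hac.trans (absolutelyContinuous_tilted hexp))
      (integrable_llr_tilted_right hac hh hllr hexp),
    integral_llr_tilted_right hac hh hexp hllr]
  simp only [probReal_univ, ENNReal.ofReal_eq_zero]
  linarith

end GibbsPosterior

theorem LCB_le_LCB_iff {ε δ γ : ℝ} {n : ℕ} (hK : 0 < 2 * ε⁻¹ - 1) (hn : 0 < n) (hγ : 0 < γ)
    (kl kl' v v' : ℝ) :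
    LCB ε δ n kl v γ ≤ LCB ε δ n kl' v' γ ↔
      γ * n / (2 * ε⁻¹ - 1) * v - kl ≤ γ * n / (2 * ε⁻¹ - 1) * v' - kl' := by
  have hn' : (0 : ℝ) < n := by exact_mod_cast hn
  have hden : 0 < 1 - exp (-γ) := by
    have : exp (-γ) < 1 := exp_lt_one_iff.2 (by linarith)
    linarith
  unfold LCB
  rw [sub_le_sub_iff_left, div_le_div_iff_of_pos_right hden, mul_le_mul_iff_of_pos_left hK,
    sub_le_sub_iff_left, exp_le_exp]
  generalize log _ = t
  generalize 2 * ε⁻¹ - 1 = K at *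
  have hrw : ∀ kl v : ℝ, -((kl + t) / n) - γ * ((ε⁻¹ - v) / K) =
      (γ * n / K * v - kl) / n - (t / n + γ * ε⁻¹ / K) := by
    intro kl v
    field_simp
    ring
  rw [hrw, hrw, sub_le_sub_iff_right, div_le_div_iff_of_pos_right hn']

section PolicyScore

variable {Ω 𝒳 𝒜 ℬ : Type*} [MeasurableSpace Ω] [MeasurableSpace 𝒳] [MeasurableSpace 𝒜]
  [MeasurableSpace ℬ] {X : Ω → 𝒳} {A : Ω → ℤ} {pr : ℤ → 𝒳 → ℝ}
  {ν : ℤ → 𝒳 → 𝒜 → ℝ} {Rl : Ω → ℝ} {f : 𝒳 → ℬ → ℝ} {ε : ℝ}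

theorem measurable_Rlow {R : Ω → ℝ} {U : 𝒳 → ℤ → ℝ → ℝ} (hX : Measurable X) (hA : Measurable A)
    (hR : Measurable R) (hU : Measurable fun q : 𝒳 × ℤ × ℝ => U q.1 q.2.1 q.2.2) :
    Measurable (Rlow X A R U) :=
  (hR.sub (hU.comp (hX.prodMk (hA.prodMk hR)))).max measurable_const

theorem measurable_Gam (hX : Measurable X) (hA : Measurable A) {a : ℤ} (hpr : Measurable (pr a))
    (hν : Measurable fun q : 𝒳 × 𝒜 => ν a q.1 q.2) (hRl : Measurable Rl) :
    Measurable fun q : 𝒜 × Ω => Gam X A pr ν Rl a q.1 q.2 := by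
  have hXq : Measurable fun q : 𝒜 × Ω => X q.2 := hX.comp measurable_snd
  have hνq : Measurable fun q : 𝒜 × Ω => ν a (X q.2) q.1 := hν.comp (hXq.prodMk measurable_fst)
  exact hνq.add (((Measurable.ite ((hA.comp measurable_snd) (measurableSet_singleton a))
    measurable_const measurable_const).div (hpr.comp hXq)).mul
      ((hRl.comp measurable_snd).sub hνq))

theorem measurable_policy_eval (hX : Measurable X) (hf : Measurable fun q : 𝒳 × ℬ => f q.1 q.2)
    {W : ℤ → (ℬ × 𝒜) × Ω → ℝ} (hW : ∀ a, Measurable (W a)) :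
    Measurable fun q : (ℬ × 𝒜) × Ω => W (if 0 ≤ f (X q.2) q.1.1 then 1 else -1) q := by
  have hd : Measurable fun q : (ℬ × 𝒜) × Ω => if 0 ≤ f (X q.2) q.1.1 then (1 : ℤ) else -1 :=
    Measurable.ite (measurableSet_le measurable_const
      (hf.comp ((hX.comp measurable_snd).prodMk (measurable_fst.comp measurable_fst))))
      measurable_const measurable_const
  exact (measurable_from_prod_countable_right (f := fun p : ℤ × ((ℬ × 𝒜) × Ω) => W p.1 p.2)
    hW).comp (hd.prodMk measurable_id)

theorem measurable_Gam_policy (hX : Measurable X) (hA : Measurable A)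
    (hpr : ∀ a, Measurable (pr a)) (hν : ∀ a, Measurable fun q : 𝒳 × 𝒜 => ν a q.1 q.2)
    (hRl : Measurable Rl) (hf : Measurable fun q : 𝒳 × ℬ => f q.1 q.2) :
    Measurable fun q : (ℬ × 𝒜) × Ω =>
      Gam X A pr ν Rl (if 0 ≤ f (X q.2) q.1.1 then 1 else -1) q.1.2 q.2 :=
  measurable_policy_eval hX hf (W := fun a q => Gam X A pr ν Rl a q.1.2 q.2) fun a =>
    (measurable_Gam hX hA (hpr a) (hν a) hRl).comp
      ((measurable_snd.comp measurable_fst).prodMk measurable_snd)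

theorem integral_Gam_policy_mem [StandardBorelSpace Ω] {P : Measure Ω} [IsProbabilityMeasure P]
    {hX : Measurable X} (hA : Measurable A) {Y : ℤ → Ω → ℝ} (hY : ∀ a, Measurable (Y a))
    (hY01 : ∀ a ω, Y a ω ∈ Set.Icc (0 : ℝ) 1)
    (hind : ∀ a ∈ ({1, -1} : Set ℤ),
      CondIndepFun (MeasurableSpace.comap X inferInstance) hX.comap_le (Y a) A P)
    (hpr : ∀ a, Measurable (pr a)) (hε : ε ∈ Set.Ioc (0 : ℝ) (1 / 2))
    (hprε : ∀ a ∈ ({1, -1} : Set ℤ), ∀ x, ε ≤ pr a x)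
    (hprver : ∀ a ∈ ({1, -1} : Set ℤ),
      (P[(fun ω => if A ω = a then (1 : ℝ) else 0) |
          MeasurableSpace.comap X inferInstance]) =ᵐ[P] fun ω => pr a (X ω))
    (hν : ∀ a, Measurable fun q : 𝒳 × 𝒜 => ν a q.1 q.2)
    (hν01 : ∀ a x α, ν a x α ∈ Set.Icc (0 : ℝ) 1) (hRlm : Measurable Rl)
    (hRl : ∀ ω, Rl ω ∈ Set.Icc (0 : ℝ) 1)
    (hle : ∀ a ∈ ({1, -1} : Set ℤ), ∀ᵐ ω ∂P, A ω = a → Rl ω ≤ Y a ω)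
    (hf : Measurable fun q : 𝒳 × ℬ => f q.1 q.2) (θ : ℬ × 𝒜) :
    ∫ ω, Gam X A pr ν Rl (if 0 ≤ f (X ω) θ.1 then 1 else -1) θ.2 ω ∂P ∈
      Set.Icc 0 (∫ ω, Y (if 0 ≤ f (X ω) θ.1 then 1 else -1) ω ∂P) := by
  have hset : MeasurableSet {x : 𝒳 | 0 ≤ f x θ.1} :=
    measurableSet_le measurable_const (hf.comp (measurable_id.prodMk measurable_const))
  set g : ℤ → 𝒳 → ℝ := fun a x => if (if 0 ≤ f x θ.1 then (1 : ℤ) else -1) = a then 1 else 0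
    with hg
  have hgm : ∀ a, Measurable (g a) := fun a =>
    Measurable.ite (Measurable.ite hset measurable_const measurable_const
      (measurableSet_singleton a)) measurable_const measurable_const
  have hg01 : ∀ a x, g a x ∈ Set.Icc (0 : ℝ) 1 := fun a x => by
    simp only [hg]
    split_ifs <;> simp
  have hsplit : ∀ (W : ℤ → Ω → ℝ) (ω : Ω), W (if 0 ≤ f (X ω) θ.1 then 1 else -1) ω =
      g 1 (X ω) * W 1 ω + g (-1) (X ω) * W (-1) ω := fun W ω => by
    simp only [hg]
    split_ifs <;> simp_all
  have hinteg : ∀ {W : Ω → ℝ} {c C : ℝ}, Measurable W → (∀ ω, W ω ∈ Set.Icc c C) →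
      ∀ a, Integrable (fun ω => g a (X ω) * W ω) P := fun hW hWb a =>
    (Integrable.of_mem_Icc _ _ hW.aemeasurable (Filter.Eventually.of_forall hWb)).bdd_mul
      ((hgm a).comp hX).aestronglyMeasurable (c := 1) (Filter.Eventually.of_forall fun ω => by
        rw [Real.norm_eq_abs, abs_of_nonneg (hg01 a _).1]
        exact (hg01 a _).2)
  have hGm : ∀ a, Measurable (Gam X A pr ν Rl a θ.2) := fun a =>
    (measurable_Gam hX hA (hpr a) (hν a) hRlm).comp (measurable_const.prodMk measurable_id)
  have hmem : ∀ a ∈ ({1, -1} : Set ℤ), ∫ ω, g a (X ω) * Gam X A pr ν Rl a θ.2 ω ∂P ∈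
      Set.Icc 0 (∫ ω, g a (X ω) * Y a ω ∂P) := fun a ha =>
    integral_mul_Gam_mem (hX := hX) hA (hY a) (hY01 a) (hind a ha) (hpr a) hε.1 (hprε a ha)
      (hprver a ha) (hν a) (hν01 a) hRlm hRl (hle a ha) (hgm a) (hg01 a) θ.2
  have hGint : ∀ a ∈ ({1, -1} : Set ℤ),
      Integrable (fun ω => g a (X ω) * Gam X A pr ν Rl a θ.2 ω) P := fun a ha =>
    hinteg (hGm a) (Gam_mem_Icc hε (hprε a ha) hν01 hRl θ.2) a
  have h1 := hmem 1 (by simp)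
  have h2 := hmem (-1) (by simp)
  simp_rw [hsplit (fun a ω => Gam X A pr ν Rl a θ.2 ω), hsplit Y]
  rw [integral_add (hGint 1 (by simp)) (hGint (-1) (by simp)),
    integral_add (hinteg (hY 1) (hY01 1) 1) (hinteg (hY (-1)) (hY01 (-1)) (-1))]
  exact ⟨add_nonneg h1.1 h2.1, add_le_add h1.2 h2.2⟩

end PolicyScore

/-- **Exact-value certification and temperature selection.** -/
theorem exact_value_certification_and_temperature_selection
    {Ω 𝒳 𝒜 ℬ : Type*} [MeasurableSpace Ω] [StandardBorelSpace Ω] [MeasurableSpace 𝒳]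
    [MeasurableSpace 𝒜] [MeasurableSpace ℬ]
    (P : Measure Ω) [IsProbabilityMeasure P]
    (X : Ω → 𝒳) (hX : Measurable X)
    (A : Ω → ℤ) (hA : Measurable A) (hA1 : ∀ ω, A ω = 1 ∨ A ω = -1)
    (R Rstar : Ω → ℝ) (hR : Measurable R) (hRstar : Measurable Rstar)
    (hR01 : ∀ ω, R ω ∈ Set.Icc (0 : ℝ) 1) (hRstar01 : ∀ ω, Rstar ω ∈ Set.Icc (0 : ℝ) 1)
    (Rpot Rstarpot : ℤ → Ω → ℝ)
    (hRpot : ∀ a, Measurable (Rpot a)) (hRstarpot : ∀ a, Measurable (Rstarpot a))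
    (hRpot01 : ∀ a ω, Rpot a ω ∈ Set.Icc (0 : ℝ) 1)
    (hRstarpot01 : ∀ a ω, Rstarpot a ω ∈ Set.Icc (0 : ℝ) 1)
    (hcons : ∀ a ∈ ({1, -1} : Set ℤ),
      ∀ᵐ ω ∂P, A ω = a → R ω = Rpot a ω ∧ Rstar ω = Rstarpot a ω)
    (hignor : CondIndepFun (MeasurableSpace.comap X inferInstance) hX.comap_le
      (fun ω => (Rpot 1 ω, Rpot (-1) ω, Rstarpot 1 ω, Rstarpot (-1) ω)) A P)
    (pr : ℤ → 𝒳 → ℝ) (hpr : ∀ a, Measurable (pr a))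
    (hprver : ∀ a ∈ ({1, -1} : Set ℤ),
      (P[(fun ω => if A ω = a then (1 : ℝ) else 0) |
          MeasurableSpace.comap X inferInstance]) =ᵐ[P] fun ω => pr a (X ω))
    (ε : ℝ) (hε : ε ∈ Set.Ioc (0 : ℝ) (1 / 2))
    (hprε : ∀ a ∈ ({1, -1} : Set ℤ), ∀ x, ε ≤ pr a x)
    (U : 𝒳 → ℤ → ℝ → ℝ)
    (hU : Measurable fun q : 𝒳 × ℤ × ℝ => U q.1 q.2.1 q.2.2)
    (hU01 : ∀ x a r, U x a r ∈ Set.Icc (0 : ℝ) 1)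
    (hcert : ∀ᵐ ω ∂P, R ω - U (X ω) (A ω) (R ω) ≤ Rstar ω)
    (ν : ℤ → 𝒳 → 𝒜 → ℝ)
    (hν : ∀ a, Measurable fun q : 𝒳 × 𝒜 => ν a q.1 q.2)
    (hν01 : ∀ a x α, ν a x α ∈ Set.Icc (0 : ℝ) 1)
    (f : 𝒳 → ℬ → ℝ) (hf : Measurable fun q : 𝒳 × ℬ => f q.1 q.2)
    (Pri : Measure (ℬ × 𝒜)) [IsProbabilityMeasure Pri]
    (n : ℕ) (hn : 0 < n) (δ : ℝ) (hδ : δ ∈ Set.Ioo (0 : ℝ) 1) :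
    -- (a) simultaneous exact-value lower confidence bound
    ENNReal.ofReal (1 - δ) ≤
      (Measure.pi fun _ : Fin n => P)
        {ωs | ∀ Q : Measure (ℬ × 𝒜), IsProbabilityMeasure Q → Q ≪ Pri →
          Integrable (llr Q Pri) Q → ∀ γ : ℝ, 0 < γ →
          LCB ε δ n (KLreal Q Pri)
              (VhatQ X A pr ν (Rlow X A R U) f n Q ωs) γ
            ≤ VstarQ P X Rstarpot f Q} ∧
    -- (b) for fixed `γ`, `Q ↦ LCB_{n,δ}(Q;γ)` is uniquely maximized by the Gibbs posterior
    (∀ ωs : Fin n → Ω, ∀ γ : ℝ, 0 < γ →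
      ∀ Q : Measure (ℬ × 𝒜), IsProbabilityMeasure Q → Q ≪ Pri →
        Integrable (llr Q Pri) Q →
        (LCB ε δ n (KLreal Q Pri) (VhatQ X A pr ν (Rlow X A R U) f n Q ωs) γ
          ≤ LCB ε δ n
              (KLreal (GibbsPost X A pr ν (Rlow X A R U) f n ε Pri γ ωs) Pri)
              (VhatQ X A pr ν (Rlow X A R U) f n
                (GibbsPost X A pr ν (Rlow X A R U) f n ε Pri γ ωs) ωs) γ) ∧
        (LCB ε δ n (KLreal Q Pri) (VhatQ X A pr ν (Rlow X A R U) f n Q ωs) γ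
            = LCB ε δ n
              (KLreal (GibbsPost X A pr ν (Rlow X A R U) f n ε Pri γ ωs) Pri)
              (VhatQ X A pr ν (Rlow X A R U) f n
                (GibbsPost X A pr ν (Rlow X A R U) f n ε Pri γ ωs) ωs) γ →
          Q = GibbsPost X A pr ν (Rlow X A R U) f n ε Pri γ ωs)) ∧
    -- (c) data-driven temperature selection over a finite grid, on the event of (a)
    (∀ ωs : Fin n → Ω,
      (∀ Q : Measure (ℬ × 𝒜), IsProbabilityMeasure Q → Q ≪ Pri →
        Integrable (llr Q Pri) Q → ∀ γ : ℝ, 0 < γ →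
        LCB ε δ n (KLreal Q Pri) (VhatQ X A pr ν (Rlow X A R U) f n Q ωs) γ
          ≤ VstarQ P X Rstarpot f Q) →
      ∀ 𝒯 : Finset ℝ, (∀ γ ∈ 𝒯, (0 : ℝ) < γ) →
      ∀ γhat ∈ 𝒯,
        (∀ γ ∈ 𝒯,
          LCB ε δ n
              (KLreal (GibbsPost X A pr ν (Rlow X A R U) f n ε Pri γ ωs) Pri)
              (VhatQ X A pr ν (Rlow X A R U) f n
                (GibbsPost X A pr ν (Rlow X A R U) f n ε Pri γ ωs) ωs) γ
            ≤ LCB ε δ n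
              (KLreal (GibbsPost X A pr ν (Rlow X A R U) f n ε Pri γhat ωs) Pri)
              (VhatQ X A pr ν (Rlow X A R U) f n
                (GibbsPost X A pr ν (Rlow X A R U) f n ε Pri γhat ωs) ωs) γhat) →
        ∀ γ ∈ 𝒯,
          LCB ε δ n
              (KLreal (GibbsPost X A pr ν (Rlow X A R U) f n ε Pri γ ωs) Pri)
              (VhatQ X A pr ν (Rlow X A R U) f n
                (GibbsPost X A pr ν (Rlow X A R U) f n ε Pri γ ωs) ωs) γ
            ≤ VstarQ P X Rstarpot f
                (GibbsPost X A pr ν (Rlow X A R U) f n ε Pri γhat ωs)) := by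

  set Rl : Ω → ℝ := Rlow X A R U
  have hn' : (0 : ℝ) < n := by exact_mod_cast hn
  have hε2 : 2 ≤ ε⁻¹ := by
    rw [le_inv_comm₀ (by norm_num) hε.1]; linarith [hε.2]
  have hK : 0 < 2 * ε⁻¹ - 1 := by linarith
  have hRl01 : ∀ ω, Rl ω ∈ Set.Icc (0 : ℝ) 1 := Rlow_mem_Icc hR01 hU01
  have hRlm : Measurable Rl := measurable_Rlow hX hA hR hU
  have hΓm := measurable_Gam_policy hX hA hpr hν hRlm hf
  have hΓb : ∀ (θ : ℬ × 𝒜) ω, Gam X A pr ν Rl (if 0 ≤ f (X ω) θ.1 then 1 else -1) θ.2 ω ∈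
      Set.Icc (1 - ε⁻¹) ε⁻¹ := fun θ ω =>
    Gam_mem_Icc hε (hprε _ (by split_ifs <;> simp)) hν01 hRl01 θ.2 ω
  have hVm : ∀ ωs : Fin n → Ω, Measurable fun θ => Vhat X A pr ν Rl f n θ ωs := fun ωs =>
    (Finset.measurable_sum _ fun i _ =>
      hΓm.comp (measurable_id.prodMk measurable_const)).const_mul _
  have hVb := Vhat_mem_Icc (X := X) (A := A) (f := f) hε hprε hν01 hRl01 hn
  have hVint : ∀ (Q : Measure (ℬ × 𝒜)) [IsProbabilityMeasure Q] (ωs : Fin n → Ω),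
      Integrable (fun θ => Vhat X A pr ν Rl f n θ ωs) Q := fun Q _ ωs =>
    Integrable.of_mem_Icc _ _ (hVm ωs).aemeasurable (Filter.Eventually.of_forall fun θ => hVb θ ωs)
  have hexp : ∀ (ωs : Fin n → Ω) (γ : ℝ), 0 < γ → Integrable
      (fun θ => exp (γ * n / (2 * ε⁻¹ - 1) * Vhat X A pr ν Rl f n θ ωs)) Pri := by
    intro ωs γ hγ
    refine Integrable.of_mem_Icc 0 (exp (γ * n / (2 * ε⁻¹ - 1) * ε⁻¹))
      ((hVm ωs).const_mul _).exp.aemeasurable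
      (Filter.Eventually.of_forall fun θ => ⟨(exp_pos _).le, exp_le_exp.2 ?_⟩)
    exact mul_le_mul_of_nonneg_left (hVb θ ωs).2 (by positivity)
  have hGprob : ∀ (ωs : Fin n → Ω) (γ : ℝ), 0 < γ →
      IsProbabilityMeasure (GibbsPost X A pr ν Rl f n ε Pri γ ωs) := fun ωs γ hγ =>
    isProbabilityMeasure_tilted (hexp ωs γ hγ)
  have hGllr : ∀ (ωs : Fin n → Ω) (γ : ℝ), 0 < γ →
      Integrable (llr (GibbsPost X A pr ν Rl f n ε Pri γ ωs) Pri)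
        (GibbsPost X A pr ν Rl f n ε Pri γ ωs) := fun ωs γ hγ => by
    have := hGprob ωs γ hγ
    exact integrable_llr_tilted_self
      ((hVint (GibbsPost X A pr ν Rl f n ε Pri γ ωs) ωs).const_mul _) (hexp ωs γ hγ)
  refine ⟨?_, ?_, ?_⟩
  · have hmem := integral_Gam_policy_mem (hX := hX) hA hRstarpot hRstarpot01 (by
        rintro a (rfl | rfl)
        · exact hignor.comp (measurable_fst.comp (measurable_snd.comp measurable_snd))
            measurable_id
        · exact hignor.comp (measurable_snd.comp (measurable_snd.comp measurable_snd))
            measurable_id) hpr hε hprε hprver hν hν01 hRlm hRl01 (fun a ha => by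
        filter_upwards [hcons a ha, hcert] with ω h1 h2 hω
        rw [← (h1 hω).2]
        exact max_le h2 (hRstar01 ω).1) hf
    have hΓint : ∀ θ : ℬ × 𝒜, Integrable
        (fun ω => Gam X A pr ν Rl (if 0 ≤ f (X ω) θ.1 then 1 else -1) θ.2 ω) P := fun θ =>
      Integrable.of_mem_Icc _ _ (hΓm.comp (measurable_const.prodMk measurable_id)).aemeasurable
        (Filter.Eventually.of_forall (hΓb θ))
    have hYm : Measurable fun q : (ℬ × 𝒜) × Ω =>
        Rstarpot (if 0 ≤ f (X q.2) q.1.1 then 1 else -1) q.2 :=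
      measurable_policy_eval hX hf (W := fun a q => Rstarpot a q.2) fun a =>
        (hRstarpot a).comp measurable_snd
    have hY01 : ∀ θ : ℬ × 𝒜, ∫ ω, Rstarpot (if 0 ≤ f (X ω) θ.1 then 1 else -1) ω ∂P ∈
        Set.Icc (0 : ℝ) 1 := fun θ => by
      refine ⟨integral_nonneg fun ω => (hRstarpot01 _ ω).1, ?_⟩
      refine (integral_mono (Integrable.of_mem_Icc 0 1
        (hYm.comp (measurable_const.prodMk measurable_id)).aemeasurable
        (Filter.Eventually.of_forall fun ω => hRstarpot01 _ ω)) (integrable_const 1)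
        fun ω => (hRstarpot01 _ ω).2).trans ?_
      simp
    set l : ℬ × 𝒜 → Ω → ℝ := fun θ ω =>
      (ε⁻¹ - Gam X A pr ν Rl (if 0 ≤ f (X ω) θ.1 then 1 else -1) θ.2 ω) / (2 * ε⁻¹ - 1) with hl
    have hL : ∀ θ, ∫ ω, l θ ω ∂P = (ε⁻¹ - ∫ ω, Gam X A pr ν Rl
        (if 0 ≤ f (X ω) θ.1 then 1 else -1) θ.2 ω ∂P) / (2 * ε⁻¹ - 1) := fun θ => by
      rw [hl, integral_div, integral_sub (integrable_const _) (hΓint θ)]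
      simp
    have hξ : √(π * n / 2) + 2 ≤ exp (1 / (12 * n)) * √(π * n / 2) + 2 := by
      have h1 : 1 ≤ exp (1 / (12 * (n : ℝ))) := one_le_exp (by positivity)
      have := le_mul_of_one_le_left (sqrt_nonneg (π * n / 2)) h1
      linarith
    refine (pacBayes_catoni_uniform P Pri l ((measurable_const.sub hΓm).div_const _) ?_ ?_ ?_ n hn
      δ _ hδ hξ).trans (measure_mono fun ωs hωs Q hQ hac hllr γ hγ => ?_)
    · intro θ ω
      obtain ⟨h1, h2⟩ := hΓb θ ω
      exact ⟨div_nonneg (by linarith) hK.le, (div_le_one hK).2 (by linarith)⟩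
    · intro θ
      rw [hL]
      exact div_pos (by linarith [(hmem θ).2, (hY01 θ).2]) hK
    · intro θ
      rw [hL, div_lt_one hK]
      linarith [(hmem θ).1]
    have hbound := hωs Q hQ hac hllr γ hγ
    have hemp : ∫ θ, (n : ℝ)⁻¹ * ∑ i, l θ (ωs i) ∂Q =
        (ε⁻¹ - VhatQ X A pr ν Rl f n Q ωs) / (2 * ε⁻¹ - 1) := by
      have hpt : ∀ θ, (n : ℝ)⁻¹ * ∑ i, l θ (ωs i) =
          (ε⁻¹ - Vhat X A pr ν Rl f n θ ωs) / (2 * ε⁻¹ - 1) := fun θ => by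
        simp only [hl, Vhat, ← Finset.sum_div, Finset.sum_sub_distrib, Finset.sum_const,
          Finset.card_univ, Fintype.card_fin, nsmul_eq_mul]
        field_simp
      simp_rw [hpt]
      rw [integral_div, integral_sub (integrable_const _) (hVint Q ωs), VhatQ]
      simp
    have hEm : Measurable fun θ : ℬ × 𝒜 =>
        ∫ ω, Gam X A pr ν Rl (if 0 ≤ f (X ω) θ.1 then 1 else -1) θ.2 ω ∂P :=
      hΓm.stronglyMeasurable.integral_prod_right'.measurable
    have hEint : Integrable (fun θ : ℬ × 𝒜 =>
        ∫ ω, Gam X A pr ν Rl (if 0 ≤ f (X ω) θ.1 then 1 else -1) θ.2 ω ∂P) Q :=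
      Integrable.of_mem_Icc 0 1 hEm.aemeasurable (Filter.Eventually.of_forall fun θ =>
        ⟨(hmem θ).1, (hmem θ).2.trans (hY01 θ).2⟩)
    have hYint : Integrable (fun θ : ℬ × 𝒜 =>
        ∫ ω, Rstarpot (if 0 ≤ f (X ω) θ.1 then 1 else -1) ω ∂P) Q :=
      Integrable.of_mem_Icc 0 1 hYm.stronglyMeasurable.integral_prod_right'.measurable.aemeasurable
        (Filter.Eventually.of_forall hY01)
    have hle : ∫ θ : ℬ × 𝒜,
        (∫ ω, Gam X A pr ν Rl (if 0 ≤ f (X ω) θ.1 then 1 else -1) θ.2 ω ∂P) ∂Q ≤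
          VstarQ P X Rstarpot f Q := integral_mono hEint hYint fun θ => (hmem θ).2
    rw [hemp] at hbound
    simp_rw [hL] at hbound
    rw [integral_div, integral_sub (integrable_const _) hEint, div_le_iff₀' hK] at hbound
    simp only [integral_const, probReal_univ, one_smul] at hbound
    rw [LCB, KLreal, mul_div_assoc]
    linarith
  · intro ωs γ hγ Q hQ hac hllr
    have := hGprob ωs γ hγ
    have hG := integral_sub_integral_llr_tilted
      ((hVint (GibbsPost X A pr ν Rl f n ε Pri γ ωs) ωs).const_mul _) (hexp ωs γ hγ)
    have hQle := integral_le_integral_llr_add_log_s13 hac hllr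
      ((hVint Q ωs).const_mul (γ * n / (2 * ε⁻¹ - 1))) (hexp ωs γ hγ)
    have hQeq := eq_tilted_of_integral_sub_integral_llr_eq hac hllr
      ((hVint Q ωs).const_mul (γ * n / (2 * ε⁻¹ - 1))) (hexp ωs γ hγ)
    rw [integral_const_mul] at hG hQle hQeq
    change γ * n / (2 * ε⁻¹ - 1) *
      VhatQ X A pr ν Rl f n (GibbsPost X A pr ν Rl f n ε Pri γ ωs) ωs -
        KLreal (GibbsPost X A pr ν Rl f n ε Pri γ ωs) Pri = _ at hG
    change γ * n / (2 * ε⁻¹ - 1) * VhatQ X A pr ν Rl f n Q ωs ≤ KLreal Q Pri + _ at hQle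
    refine ⟨(LCB_le_LCB_iff hK hn hγ _ _ _ _).2 (by linarith), fun heq => hQeq ?_⟩
    have hge := (LCB_le_LCB_iff hK hn hγ _ _ _ _).1 heq.ge
    change γ * n / (2 * ε⁻¹ - 1) * VhatQ X A pr ν Rl f n Q ωs - KLreal Q Pri = _
    linarith
  · intro ωs hωs 𝒯 h𝒯 γhat hγhat hmax γ hγ
    exact (hmax γ hγ).trans (hωs _ (hGprob ωs γhat (h𝒯 _ hγhat))
      (tilted_absolutelyContinuous _ _) (hGllr ωs γhat (h𝒯 _ hγhat)) γhat (h𝒯 _ hγhat))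
end

section
/- Fix α ∈ 𝒜 and define u_α(x) := E[ W_α(Z)·1{Y_α(Z) = 1} | X = x ] and v_α(x) := E[ W_α(Z)·1{Y_α(Z) = −1} | X = x ]. Then, under the identification and positivity assumption, for P_X-almost every x, u_α(x) − v_α(x) = μ_1(x) − μ_{−1}(x). -/
open MeasureTheory ProbabilityTheory Real

/-- the certified advantage `D_α(Z) = Γ_1^α(Z) − Γ_{−1}^α(Z)` -/
noncomputable def Dadv {Ω 𝒳 𝒜 : Type*} (X : Ω → 𝒳) (A : Ω → ℤ) (pr : ℤ → 𝒳 → ℝ)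
    (ν : ℤ → 𝒳 → 𝒜 → ℝ) (Rl : Ω → ℝ) (α : 𝒜) (ω : Ω) : ℝ :=
  Gam X A pr ν Rl 1 α ω - Gam X A pr ν Rl (-1) α ω

/-- Inverse weighting by the propensity `p = E[I | X]` with an augmentation term `n` recovers the
regression function `r`, where `E[Q | X] = r p`. -/
theorem condExp_augmented_inverse_weighting
    {Ω 𝒳 : Type*} [MeasurableSpace Ω] [MeasurableSpace 𝒳]
    {P : Measure Ω} [IsFiniteMeasure P] {X : Ω → 𝒳} (hX : Measurable X)
    {n p r : 𝒳 → ℝ} (hn : Measurable n) (hp : Measurable p)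
    {c : ℝ} (hnc : ∀ x, |n x| ≤ c) {ε : ℝ} (hε : 0 < ε) (hpε : ∀ x, ε ≤ p x)
    {I Q : Ω → ℝ} (hI : Integrable I P) (hQ : Integrable Q P)
    (hIp : P[I | MeasurableSpace.comap X inferInstance] =ᵐ[P] fun ω => p (X ω))
    (hQr : P[Q | MeasurableSpace.comap X inferInstance] =ᵐ[P] fun ω => r (X ω) * p (X ω)) :
    Integrable (fun ω => n (X ω) + ((p (X ω))⁻¹ * Q ω - n (X ω) * (p (X ω))⁻¹ * I ω)) P ∧
    P[fun ω => n (X ω) + ((p (X ω))⁻¹ * Q ω - n (X ω) * (p (X ω))⁻¹ * I ω) |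
      MeasurableSpace.comap X inferInstance] =ᵐ[P] fun ω => r (X ω) := by
  have hm := hX.comap_le
  have hXm : Measurable[MeasurableSpace.comap X inferInstance] X := comap_measurable X
  have hinv : ∀ x, |(p x)⁻¹| ≤ ε⁻¹ := fun x => by
    rw [abs_of_pos (inv_pos.2 (hε.trans_le (hpε x)))]
    exact inv_anti₀ hε (hpε x)
  have hquot : ∀ x, |n x * (p x)⁻¹| ≤ c * ε⁻¹ := fun x => by
    rw [abs_mul]
    exact mul_le_mul (hnc x) (hinv x) (abs_nonneg _) ((abs_nonneg _).trans (hnc x))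
  have hpi := hp.inv
  have hnp := hn.mul hpi
  have hnX : Integrable (fun ω => n (X ω)) P :=
    .of_bound (hn.comp hX).aestronglyMeasurable c (.of_forall fun ω => hnc _)
  have hQi : Integrable ((fun ω => (p (X ω))⁻¹) * Q) P :=
    hQ.bdd_mul (hpi.comp hX).aestronglyMeasurable (.of_forall fun ω => hinv _)
  have hIi : Integrable ((fun ω => n (X ω) * (p (X ω))⁻¹) * I) P :=
    hI.bdd_mul (hnp.comp hX).aestronglyMeasurable (.of_forall fun ω => hquot _)
  refine ⟨hnX.add (hQi.sub hIi), ?_⟩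
  have hE := condExp_add hnX (hQi.sub hIi) (MeasurableSpace.comap X inferInstance)
  have hE' := condExp_sub hQi hIi (MeasurableSpace.comap X inferInstance)
  have hEn : P[fun ω => n (X ω) | MeasurableSpace.comap X inferInstance] = fun ω => n (X ω) :=
    condExp_of_stronglyMeasurable hm (hn.comp hXm).stronglyMeasurable hnX
  have hEQ : P[(fun ω => (p (X ω))⁻¹) * Q | MeasurableSpace.comap X inferInstance] =ᵐ[P]
      (fun ω => (p (X ω))⁻¹) * P[Q | MeasurableSpace.comap X inferInstance] :=
    condExp_stronglyMeasurable_mul_of_bound hm (hpi.comp hXm).stronglyMeasurable hQ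
      ε⁻¹ (.of_forall fun ω => hinv (X ω))
  have hEI : P[(fun ω => n (X ω) * (p (X ω))⁻¹) * I | MeasurableSpace.comap X inferInstance] =ᵐ[P]
      (fun ω => n (X ω) * (p (X ω))⁻¹) * P[I | MeasurableSpace.comap X inferInstance] :=
    condExp_stronglyMeasurable_mul_of_bound hm (hnp.comp hXm).stronglyMeasurable hI
      (c * ε⁻¹) (.of_forall fun ω => hquot (X ω))
  refine hE.trans ?_
  filter_upwards [hE', hEQ, hEI, hIp, hQr] with ω h' hQω hIω hpω hrω
  have hp0 : p (X ω) ≠ 0 := (hε.trans_le (hpε _)).ne'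
  rw [Pi.add_apply, h', Pi.sub_apply, hQω, hIω, hEn]
  simp only [Pi.mul_apply, hpω, hrω]
  field_simp
  ring

/-- **The conditional signed weight identity `u_α − v_α = μ₁ − μ₋₁`.** -/
theorem signed_weight_identity
    {Ω 𝒳 𝒜 : Type*} [MeasurableSpace Ω] [MeasurableSpace 𝒳] [MeasurableSpace 𝒜]
    (P : Measure Ω) [IsProbabilityMeasure P]
    (X : Ω → 𝒳) (hX : Measurable X)
    (A : Ω → ℤ) (hA : Measurable A) (hA1 : ∀ ω, A ω = 1 ∨ A ω = -1)
    (R : Ω → ℝ) (hR : Measurable R) (hR01 : ∀ ω, R ω ∈ Set.Icc (0 : ℝ) 1)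
    (Rl : Ω → ℝ) (hRl : Measurable Rl) (hRl01 : ∀ ω, Rl ω ∈ Set.Icc (0 : ℝ) 1)
    (pr : ℤ → 𝒳 → ℝ) (hpr : ∀ a, Measurable (pr a))
    (hprver : ∀ a ∈ ({1, -1} : Set ℤ),
      (P[(fun ω => if A ω = a then (1 : ℝ) else 0) |
          MeasurableSpace.comap X inferInstance]) =ᵐ[P] fun ω => pr a (X ω))
    (ε : ℝ) (hε : ε ∈ Set.Ioc (0 : ℝ) (1 / 2))
    (hprε : ∀ a ∈ ({1, -1} : Set ℤ), ∀ x, ε ≤ pr a x)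
    (ν : ℤ → 𝒳 → 𝒜 → ℝ)
    (hν : ∀ a, Measurable fun q : 𝒳 × 𝒜 => ν a q.1 q.2)
    (hν01 : ∀ a x α, ν a x α ∈ Set.Icc (0 : ℝ) 1)
    (μ : ℤ → 𝒳 → ℝ) (hμmeas : ∀ a, Measurable (μ a))
    (hμ : ∀ a ∈ ({1, -1} : Set ℤ),
      (P[(fun ω => Rl ω * (if A ω = a then (1 : ℝ) else 0)) |
          MeasurableSpace.comap X inferInstance])
        =ᵐ[P] fun ω => μ a (X ω) * pr a (X ω))
    -- fix `α`, with `u_α(x) = E[W_α·1{Y_α = 1} | X = x]`, `v_α(x) = E[W_α·1{Y_α = −1} | X = x]`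
    (α : 𝒜)
    (u v : 𝒳 → ℝ) (humeas : Measurable u) (hvmeas : Measurable v)
    (hu : (P[(fun ω => |Dadv X A pr ν Rl α ω|
          * (if (if 0 ≤ Dadv X A pr ν Rl α ω then (1 : ℤ) else -1) = 1
              then (1 : ℝ) else 0)) |
        MeasurableSpace.comap X inferInstance]) =ᵐ[P] fun ω => u (X ω))
    (hv : (P[(fun ω => |Dadv X A pr ν Rl α ω|
          * (if (if 0 ≤ Dadv X A pr ν Rl α ω then (1 : ℤ) else -1) = -1
              then (1 : ℝ) else 0)) |
        MeasurableSpace.comap X inferInstance]) =ᵐ[P] fun ω => v (X ω)) :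
    ∀ᵐ x ∂(P.map X), u x - v x = μ 1 x - μ (-1) x := by
  have hGam : ∀ a ∈ ({1, -1} : Set ℤ), Integrable (Gam X A pr ν Rl a α) P ∧
      P[Gam X A pr ν Rl a α | MeasurableSpace.comap X inferInstance]
        =ᵐ[P] fun ω => μ a (X ω) := by
    intro a ha
    have hIm : Measurable fun ω => if A ω = a then (1 : ℝ) else 0 :=
      Measurable.ite (hA (measurableSet_singleton a)) measurable_const measurable_const
    have hI : Integrable (fun ω => if A ω = a then (1 : ℝ) else 0) P :=
      .of_bound hIm.aestronglyMeasurable 1 (.of_forall fun ω => by split_ifs <;> simp)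
    have hQ : Integrable (fun ω => Rl ω * (if A ω = a then (1 : ℝ) else 0)) P :=
      hI.bdd_mul (c := 1) hRl.aestronglyMeasurable
        (.of_forall fun ω => abs_le.2 ⟨by linarith [(hRl01 ω).1], (hRl01 ω).2⟩)
    have hνm : Measurable fun x => ν a x α := (hν a).comp measurable_prodMk_right
    have hG : Gam X A pr ν Rl a α = fun ω => ν a (X ω) α +
        ((pr a (X ω))⁻¹ * (Rl ω * (if A ω = a then (1 : ℝ) else 0)) -
          ν a (X ω) α * (pr a (X ω))⁻¹ * (if A ω = a then (1 : ℝ) else 0)) := by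
      funext ω
      simp only [Gam]
      ring
    rw [hG]
    exact condExp_augmented_inverse_weighting hX hνm (hpr a) (c := 1)
      (fun x => abs_le.2 ⟨by linarith [(hν01 a x α).1], (hν01 a x α).2⟩) hε.1 (hprε a ha)
      hI hQ (hprver a ha) (hμ a ha)
  obtain ⟨hi₁, hE₁⟩ := hGam 1 (by simp)
  obtain ⟨hi₂, hE₂⟩ := hGam (-1) (by simp)
  have hD : Integrable (Dadv X A pr ν Rl α) P := hi₁.sub hi₂
  have hpos : (fun ω => |Dadv X A pr ν Rl α ω|
      * (if (if 0 ≤ Dadv X A pr ν Rl α ω then (1 : ℤ) else -1) = 1 then (1 : ℝ) else 0))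
      = fun ω => max (Dadv X A pr ν Rl α ω) 0 := by
    funext ω
    rcases le_or_gt 0 (Dadv X A pr ν Rl α ω) with h | h
    · simp [h, abs_of_nonneg h]
    · simp [h.not_ge, h.le]
  have hneg : (fun ω => |Dadv X A pr ν Rl α ω|
      * (if (if 0 ≤ Dadv X A pr ν Rl α ω then (1 : ℤ) else -1) = -1 then (1 : ℝ) else 0))
      = fun ω => max (-Dadv X A pr ν Rl α ω) 0 := by
    funext ω
    rcases le_or_gt 0 (Dadv X A pr ν Rl α ω) with h | h
    · simp [h]
    · simp [h.not_ge, h.le, abs_of_neg h]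
  rw [hpos] at hu
  rw [hneg] at hv
  have hsplit : (fun ω => max (Dadv X A pr ν Rl α ω) 0)
      - (fun ω => max (-Dadv X A pr ν Rl α ω) 0)
      = Gam X A pr ν Rl 1 α - Gam X A pr ν Rl (-1) α := by
    funext ω
    exact max_zero_sub_eq_self (Dadv X A pr ν Rl α ω)
  have hW := condExp_sub hD.pos_part hD.neg_part (MeasurableSpace.comap X inferInstance)
  rw [hsplit] at hW
  have hΓ := condExp_sub hi₁ hi₂ (MeasurableSpace.comap X inferInstance)
  refine (ae_map_iff hX.aemeasurable (measurableSet_eq_fun (humeas.sub hvmeas)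
    ((hμmeas 1).sub (hμmeas (-1))))).2 ?_
  filter_upwards [hW, hΓ, hu, hv, hE₁, hE₂] with ω hWω hΓω huω hvω h₁ h₂
  rw [hWω, Pi.sub_apply, Pi.sub_apply, huω, hvω, h₁, h₂] at hΓω
  exact hΓω
end

section
/- Fix α ∈ 𝒜, and define u_α(x) := E[ W_α(Z)·1{Y_α(Z) = 1} | X = x ], v_α(x) := E[ W_α(Z)·1{Y_α(Z) = −1} | X = x ], and the score g†_α(x) := 1 if u_α(x) > v_α(x), := −1 if u_α(x) < v_α(x), and := 0 if u_α(x) = v_α(x). Then, under the identification and positivity assumption, g†_α minimizes the certified hinge risk R_h^α(g) := E[ W_α(Z)·(1 − Y_α(Z)·g(X))₊ ] over all measurable scores g : 𝒳 → ℝ, and the induced rule d_{g†_α}(x) := sgn(g†_α(x)) (sgn(0)=1) is Bayes-optimal for the certified value V_R̲; i.e., the certified hinge loss is Fisher-consistent for certified value maximization. -/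
open MeasureTheory ProbabilityTheory Real
open scoped ENNReal

/-- measurable individualized treatment rule with values in `{−1,1}` -/
def IsRule {𝒳 : Type*} [MeasurableSpace 𝒳] (d : 𝒳 → ℤ) : Prop :=
  Measurable d ∧ ∀ x, d x = 1 ∨ d x = -1

/-- the certified value `V_R̲(d)` -/
noncomputable def VR {Ω 𝒳 : Type*} [MeasurableSpace Ω] (P : Measure Ω)
    (X : Ω → 𝒳) (A : Ω → ℤ) (pr : ℤ → 𝒳 → ℝ) (Rl : Ω → ℝ) (d : 𝒳 → ℤ) : ℝ :=
  ∫ ω, Rl ω * (if A ω = d (X ω) then (1 : ℝ) else 0) / pr (A ω) (X ω) ∂P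

/-- the certified hinge risk `R_h^α(g) = E[ W_α(Z)·(1 − Y_α(Z)·g(X))₊ ]` -/
noncomputable def hingeRisk {Ω 𝒳 𝒜 : Type*} [MeasurableSpace Ω] (P : Measure Ω)
    (X : Ω → 𝒳) (A : Ω → ℤ) (pr : ℤ → 𝒳 → ℝ)
    (ν : ℤ → 𝒳 → 𝒜 → ℝ) (Rl : Ω → ℝ) (α : 𝒜) (g : 𝒳 → ℝ) : ℝ≥0∞ :=
  ∫⁻ ω, ENNReal.ofReal (|Dadv X A pr ν Rl α ω|
    * max (1 - (if 0 ≤ Dadv X A pr ν Rl α ω then (1 : ℝ) else -1) * g (X ω)) 0) ∂P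

/-- Pulling out a bounded function of `X`: if `φ ∘ X` is a version of `E[f | X]`, then
`E[f · h(X)] = E[φ(X) · h(X)]`. -/
theorem integral_mul_comp_eq_of_condExp {Ω 𝒳 : Type*} [MeasurableSpace Ω] [MeasurableSpace 𝒳]
    {P : Measure Ω} [IsProbabilityMeasure P] {X : Ω → 𝒳} (hX : Measurable X)
    {f : Ω → ℝ} (hf : Integrable f P) {φ : 𝒳 → ℝ}
    (hφ : P[f | MeasurableSpace.comap X inferInstance] =ᵐ[P] fun ω => φ (X ω))
    {h : 𝒳 → ℝ} (hh : Measurable h) {C : ℝ} (hC : ∀ x, |h x| ≤ C) :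
    ∫ ω, f ω * h (X ω) ∂P = ∫ ω, φ (X ω) * h (X ω) ∂P := by
  have hm : MeasurableSpace.comap X inferInstance ≤ (inferInstance : MeasurableSpace Ω) :=
    hX.comap_le
  have hhX : StronglyMeasurable[MeasurableSpace.comap X inferInstance] fun ω => h (X ω) :=
    (hh.comp (comap_measurable X)).stronglyMeasurable
  have hint : Integrable (fun ω => f ω * h (X ω)) P :=
    hf.mul_bdd (hh.comp hX).aestronglyMeasurable (ae_of_all _ fun ω => hC _)
  rw [← integral_condExp hm]
  refine integral_congr_ae ?_
  have := condExp_mul_of_stronglyMeasurable_right hhX hint hf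
  filter_upwards [this, hφ] with ω h1 h2
  exact h1.trans (by simp [h2])

/-- Among weights bounded by one, the sign of the regression function `φ` maximizes the
correlation with `f`. -/
theorem integral_mul_comp_le_of_mul_eq_abs {Ω 𝒳 : Type*} [MeasurableSpace Ω]
    [MeasurableSpace 𝒳] {P : Measure Ω} [IsProbabilityMeasure P] {X : Ω → 𝒳}
    (hX : Measurable X) {f : Ω → ℝ} (hf : Integrable f P) {φ : 𝒳 → ℝ}
    (hφ : P[f | MeasurableSpace.comap X inferInstance] =ᵐ[P] fun ω => φ (X ω))
    {s t : 𝒳 → ℝ} (hs : Measurable s) (ht : Measurable t)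
    (hs1 : ∀ x, |s x| ≤ 1) (ht1 : ∀ x, |t x| ≤ 1) (hφt : ∀ x, φ x * t x = |φ x|) :
    ∫ ω, f ω * s (X ω) ∂P ≤ ∫ ω, f ω * t (X ω) ∂P := by
  have hφint : Integrable (fun ω => φ (X ω)) P := integrable_condExp.congr hφ
  rw [integral_mul_comp_eq_of_condExp hX hf hφ hs hs1,
    integral_mul_comp_eq_of_condExp hX hf hφ ht ht1]
  refine integral_mono
    (hφint.mul_bdd (hs.comp hX).aestronglyMeasurable (ae_of_all _ fun ω => hs1 _))
    (hφint.mul_bdd (ht.comp hX).aestronglyMeasurable (ae_of_all _ fun ω => ht1 _))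
    fun ω => ?_
  change φ (X ω) * s (X ω) ≤ φ (X ω) * t (X ω)
  rw [hφt]
  calc φ (X ω) * s (X ω) ≤ |φ (X ω)| * |s (X ω)| := by
        rw [← abs_mul]; exact le_abs_self _
    _ ≤ |φ (X ω)| := mul_le_of_le_one_right (abs_nonneg _) (hs1 _)

/-- For scores bounded by one the hinge is inactive and the hinge risk is affine. -/
theorem hingeRisk_eq_ofReal_integral {Ω 𝒳 𝒜 : Type*} [MeasurableSpace Ω] [MeasurableSpace 𝒳]
    {P : Measure Ω} {X : Ω → 𝒳} (hX : Measurable X) {A : Ω → ℤ} {pr : ℤ → 𝒳 → ℝ}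
    {ν : ℤ → 𝒳 → 𝒜 → ℝ} {Rl : Ω → ℝ} {α : 𝒜} (hD : Integrable (Dadv X A pr ν Rl α) P)
    {g : 𝒳 → ℝ} (hg : Measurable g) (hg1 : ∀ x, |g x| ≤ 1) :
    hingeRisk P X A pr ν Rl α g = ENNReal.ofReal
      (∫ ω, |Dadv X A pr ν Rl α ω| ∂P - ∫ ω, Dadv X A pr ν Rl α ω * g (X ω) ∂P) := by
  have hDg : Integrable (fun ω => Dadv X A pr ν Rl α ω * g (X ω)) P :=
    hD.mul_bdd (hg.comp hX).aestronglyMeasurable (ae_of_all _ fun ω => hg1 _)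
  rw [← integral_sub hD.abs hDg, ofReal_integral_eq_lintegral_ofReal
    (f := fun ω => |Dadv X A pr ν Rl α ω| - Dadv X A pr ν Rl α ω * g (X ω)) (hD.abs.sub hDg)]
  · refine lintegral_congr fun ω => ?_
    congr 1
    obtain ⟨h1, h2⟩ := abs_le.mp (hg1 (X ω))
    split_ifs with h
    · rw [max_eq_left (by linarith), abs_of_nonneg h]; ring
    · rw [max_eq_left (by linarith), abs_of_neg (not_le.mp h)]; ring
  · refine ae_of_all _ fun ω => ?_
    change 0 ≤ |Dadv X A pr ν Rl α ω| - Dadv X A pr ν Rl α ω * g (X ω)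
    have : Dadv X A pr ν Rl α ω * g (X ω) ≤ |Dadv X A pr ν Rl α ω| * |g (X ω)| := by
      rw [← abs_mul]; exact le_abs_self _
    have := mul_le_of_le_one_right (abs_nonneg (Dadv X A pr ν Rl α ω)) (hg1 (X ω))
    linarith

/-- Clipping a score to `[-1, 1]` does not increase the hinge risk. -/
theorem hingeRisk_clip_le {Ω 𝒳 𝒜 : Type*} [MeasurableSpace Ω] (P : Measure Ω)
    (X : Ω → 𝒳) (A : Ω → ℤ) (pr : ℤ → 𝒳 → ℝ) (ν : ℤ → 𝒳 → 𝒜 → ℝ) (Rl : Ω → ℝ) (α : 𝒜)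
    (g : 𝒳 → ℝ) :
    hingeRisk P X A pr ν Rl α (fun x => max (-1) (min 1 (g x)))
      ≤ hingeRisk P X A pr ν Rl α g := by
  refine lintegral_mono fun ω => ENNReal.ofReal_le_ofReal ?_
  refine mul_le_mul_of_nonneg_left ?_ (abs_nonneg _)
  split_ifs
  · rcases le_total 1 (g (X ω)) with h1 | h1 <;> rcases le_total (-1) (g (X ω)) with h2 | h2 <;>
      simp only [h1, max_def, min_def] <;> split_ifs <;> linarith
  · rcases le_total 1 (g (X ω)) with h1 | h1 <;> rcases le_total (-1) (g (X ω)) with h2 | h2 <;>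
      simp only [h1, max_def, min_def] <;> split_ifs <;> linarith

theorem abs_treatment_weight_le {ε p : ℝ} (hε : 0 < ε) (hp : ε ≤ p) (c : Prop) [Decidable c] :
    |(if c then (1 : ℝ) else 0) / p| ≤ 1 / ε := by
  have hp0 : 0 < p := hε.trans_le hp
  split_ifs
  · rw [abs_of_pos (by positivity)]
    exact one_div_le_one_div_of_le hε hp
  · simp [hε.le]

theorem measurable_indicator_treatment {Ω : Type*} [MeasurableSpace Ω] {A : Ω → ℤ}
    (hA : Measurable A) (a : ℤ) : Measurable fun ω => if A ω = a then (1 : ℝ) else 0 :=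
  Measurable.ite (hA (measurableSet_singleton a)) measurable_const measurable_const

theorem integrable_Gam {Ω 𝒳 𝒜 : Type*} [MeasurableSpace Ω] [MeasurableSpace 𝒳]
    {P : Measure Ω} [IsProbabilityMeasure P] {X : Ω → 𝒳} (hX : Measurable X)
    {A : Ω → ℤ} (hA : Measurable A) {Rl : Ω → ℝ} (hRl : Measurable Rl)
    (hRl01 : ∀ ω, Rl ω ∈ Set.Icc (0 : ℝ) 1) {pr : ℤ → 𝒳 → ℝ} {a : ℤ}
    (hpr : Measurable (pr a)) {ε : ℝ} (hε : 0 < ε) (hprε : ∀ x, ε ≤ pr a x)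
    {ν : ℤ → 𝒳 → 𝒜 → ℝ} {α : 𝒜} (hν : Measurable fun x => ν a x α)
    (hν01 : ∀ x, ν a x α ∈ Set.Icc (0 : ℝ) 1) :
    Integrable (Gam X A pr ν Rl a α) P := by
  have hνX : Measurable fun ω => ν a (X ω) α := hν.comp hX
  have hw : Measurable fun ω => (if A ω = a then (1 : ℝ) else 0) / pr a (X ω) :=
    (measurable_indicator_treatment hA a).div (hpr.comp hX)
  have hνint : Integrable (fun ω => ν a (X ω) α) P :=
    Integrable.of_bound hνX.aestronglyMeasurable 1 (ae_of_all _ fun ω => by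
      rw [Real.norm_eq_abs, abs_of_nonneg (hν01 _).1]; exact (hν01 _).2)
  have hRint : Integrable Rl P :=
    Integrable.of_bound hRl.aestronglyMeasurable 1 (ae_of_all _ fun ω => by
      rw [Real.norm_eq_abs, abs_of_nonneg (hRl01 _).1]; exact (hRl01 _).2)
  exact hνint.add ((hRint.sub hνint).bdd_mul (c := 1 / ε) hw.aestronglyMeasurable
    (ae_of_all _ fun ω => abs_treatment_weight_le hε (hprε _) _))

/-- Inverse-propensity weights are centered: the augmentation term has mean zero. -/
theorem integral_augmentation_eq_zero {Ω 𝒳 : Type*} [MeasurableSpace Ω] [MeasurableSpace 𝒳]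
    {P : Measure Ω} [IsProbabilityMeasure P] {X : Ω → 𝒳} (hX : Measurable X)
    {A : Ω → ℤ} (hA : Measurable A) {a : ℤ} {p : 𝒳 → ℝ} (hp : Measurable p)
    (hpver : P[(fun ω => if A ω = a then (1 : ℝ) else 0) |
      MeasurableSpace.comap X inferInstance] =ᵐ[P] fun ω => p (X ω))
    {ε : ℝ} (hε : 0 < ε) (hpε : ∀ x, ε ≤ p x)
    {h : 𝒳 → ℝ} (hh : Measurable h) (hh1 : ∀ x, |h x| ≤ 1) :
    Integrable (fun ω => h (X ω) * (1 - (if A ω = a then (1 : ℝ) else 0) / p (X ω))) P ∧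
      ∫ ω, h (X ω) * (1 - (if A ω = a then (1 : ℝ) else 0) / p (X ω)) ∂P = 0 := by
  have hp0 : ∀ x, 0 < p x := fun x => hε.trans_le (hpε x)
  have hI : Integrable (fun ω => if A ω = a then (1 : ℝ) else 0) P :=
    Integrable.of_bound (measurable_indicator_treatment hA a).aestronglyMeasurable 1
      (ae_of_all _ fun ω => by split_ifs <;> simp)
  have hhp : Measurable fun x => h x / p x := hh.div hp
  have hbound : ∀ x, |h x / p x| ≤ 1 / ε := fun x => by
    rw [abs_div, abs_of_pos (hp0 x)]
    exact div_le_div₀ zero_le_one (hh1 x) hε (hpε x)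
  have hhint : Integrable (fun ω => h (X ω)) P :=
    Integrable.of_bound (hh.comp hX).aestronglyMeasurable 1 (ae_of_all _ fun ω => hh1 _)
  have hIint : Integrable (fun ω => (if A ω = a then (1 : ℝ) else 0) * (h (X ω) / p (X ω))) P :=
    hI.mul_bdd (hhp.comp hX).aestronglyMeasurable (ae_of_all _ fun ω => hbound _)
  have key := integral_mul_comp_eq_of_condExp hX hI hpver hhp hbound
  have hrw : (fun ω => h (X ω) * (1 - (if A ω = a then (1 : ℝ) else 0) / p (X ω))) =
      fun ω => h (X ω) - (if A ω = a then (1 : ℝ) else 0) * (h (X ω) / p (X ω)) := by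
    funext ω; ring
  rw [hrw]
  refine ⟨hhint.sub hIint, ?_⟩
  rw [integral_sub hhint hIint, key, sub_eq_zero]
  refine integral_congr_ae (ae_of_all _ fun ω => ?_)
  have := (hp0 (X ω)).ne'
  field_simp

/-- The certified value of a rule is an affine function of the correlation of the rule with the
doubly robust advantage, whatever the nuisance parameter. -/
theorem VR_eq_add_integral_Dadv {Ω 𝒳 𝒜 : Type*} [MeasurableSpace Ω] [MeasurableSpace 𝒳]
    {P : Measure Ω} [IsProbabilityMeasure P] {X : Ω → 𝒳} (hX : Measurable X)
    {A : Ω → ℤ} (hA : Measurable A) (hA1 : ∀ ω, A ω = 1 ∨ A ω = -1)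
    {Rl : Ω → ℝ} (hRl : Measurable Rl) (hRl01 : ∀ ω, Rl ω ∈ Set.Icc (0 : ℝ) 1)
    {pr : ℤ → 𝒳 → ℝ} (hpr : ∀ a, Measurable (pr a))
    (hprver : ∀ a ∈ ({1, -1} : Set ℤ),
      (P[(fun ω => if A ω = a then (1 : ℝ) else 0) |
          MeasurableSpace.comap X inferInstance]) =ᵐ[P] fun ω => pr a (X ω))
    {ε : ℝ} (hε : 0 < ε) (hprε : ∀ a ∈ ({1, -1} : Set ℤ), ∀ x, ε ≤ pr a x)
    {ν : ℤ → 𝒳 → 𝒜 → ℝ} {α : 𝒜} (hν : ∀ a, Measurable fun x => ν a x α)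
    (hν01 : ∀ a x, ν a x α ∈ Set.Icc (0 : ℝ) 1)
    (hD : Integrable (Dadv X A pr ν Rl α) P) {d : 𝒳 → ℤ} (hd : IsRule d) :
    VR P X A pr Rl d = (∫ ω, Rl ω * (((if A ω = 1 then (1 : ℝ) else 0) / pr 1 (X ω)
        + (if A ω = -1 then (1 : ℝ) else 0) / pr (-1) (X ω)) / 2) ∂P)
      + (∫ ω, Dadv X A pr ν Rl α ω * (d (X ω) : ℝ) ∂P) / 2 := by
  have hdm : Measurable fun x => (d x : ℝ) := measurable_from_top.comp hd.1
  have hd1 : ∀ x, |(d x : ℝ)| ≤ 1 := fun x => by rcases hd.2 x with h | h <;> simp [h]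
  have haug : ∀ a ∈ ({1, -1} : Set ℤ), _ := fun a ha =>
    integral_augmentation_eq_zero hX hA (hpr a) (hprver a ha) hε (hprε a ha)
      ((hν a).mul hdm) (fun x => by
        rw [Pi.mul_apply, abs_mul, abs_of_nonneg (hν01 a x).1]
        exact mul_le_one₀ (hν01 a x).2 (abs_nonneg _) (hd1 x))
  obtain ⟨hi1, he1⟩ := haug 1 (by simp)
  obtain ⟨hi2, he2⟩ := haug (-1) (by simp)
  have hRint : Integrable Rl P :=
    Integrable.of_bound hRl.aestronglyMeasurable 1 (ae_of_all _ fun ω => by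
      rw [Real.norm_eq_abs, abs_of_nonneg (hRl01 _).1]; exact (hRl01 _).2)
  have hbase : Integrable (fun ω => Rl ω * (((if A ω = 1 then (1 : ℝ) else 0) / pr 1 (X ω)
        + (if A ω = -1 then (1 : ℝ) else 0) / pr (-1) (X ω)) / 2)) P := by
    refine hRint.mul_bdd (c := 1 / ε) ?_ (ae_of_all _ fun ω => ?_)
    · exact ((((measurable_indicator_treatment hA 1).div ((hpr 1).comp hX)).add
        ((measurable_indicator_treatment hA (-1)).div ((hpr (-1)).comp hX))).div_const
          2).aestronglyMeasurable
    · have h1 := abs_le.mp (abs_treatment_weight_le hε (hprε 1 (by simp) (X ω)) (A ω = 1))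
      have h2 := abs_le.mp (abs_treatment_weight_le hε (hprε (-1) (by simp) (X ω)) (A ω = -1))
      rw [Real.norm_eq_abs, abs_le]
      constructor <;> linarith [h1.1, h1.2, h2.1, h2.2]
  have hDd : Integrable (fun ω => Dadv X A pr ν Rl α ω * (d (X ω) : ℝ)) P :=
    hD.mul_bdd (hdm.comp hX).aestronglyMeasurable (ae_of_all _ fun ω => hd1 _)
  have hpt : ∀ ω, Rl ω * (if A ω = d (X ω) then (1 : ℝ) else 0) / pr (A ω) (X ω) =
      Rl ω * (((if A ω = 1 then (1 : ℝ) else 0) / pr 1 (X ω)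
        + (if A ω = -1 then (1 : ℝ) else 0) / pr (-1) (X ω)) / 2)
      + (Dadv X A pr ν Rl α ω * (d (X ω) : ℝ)
        - ν 1 (X ω) α * (d (X ω) : ℝ) * (1 - (if A ω = 1 then (1 : ℝ) else 0) / pr 1 (X ω))
        + ν (-1) (X ω) α * (d (X ω) : ℝ)
          * (1 - (if A ω = -1 then (1 : ℝ) else 0) / pr (-1) (X ω))) / 2 := by
    intro ω
    rcases hA1 ω with h | h <;> rcases hd.2 (X ω) with h' | h' <;>
      simp [h, h', Dadv, Gam] <;> ring
  have hsub := hDd.sub hi1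
  rw [VR, integral_congr_ae (ae_of_all _ hpt)]
  refine (integral_add hbase ((hsub.add hi2).div_const 2)).trans ?_
  congr 1
  refine (integral_div _ _).trans ?_
  congr 1
  refine (integral_add hsub hi2).trans ?_
  rw [he2, add_zero]
  refine (integral_sub hDd hi1).trans ?_
  rw [he1, sub_zero]

/-- **Fisher consistency of the certified hinge loss.** -/
theorem certified_hinge_fisher_consistency
    {Ω 𝒳 𝒜 : Type*} [MeasurableSpace Ω] [MeasurableSpace 𝒳] [MeasurableSpace 𝒜]
    (P : Measure Ω) [IsProbabilityMeasure P]
    (X : Ω → 𝒳) (hX : Measurable X)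
    (A : Ω → ℤ) (hA : Measurable A) (hA1 : ∀ ω, A ω = 1 ∨ A ω = -1)
    (R : Ω → ℝ) (hR : Measurable R) (hR01 : ∀ ω, R ω ∈ Set.Icc (0 : ℝ) 1)
    (Rl : Ω → ℝ) (hRl : Measurable Rl) (hRl01 : ∀ ω, Rl ω ∈ Set.Icc (0 : ℝ) 1)
    (pr : ℤ → 𝒳 → ℝ) (hpr : ∀ a, Measurable (pr a))
    (hprver : ∀ a ∈ ({1, -1} : Set ℤ),
      (P[(fun ω => if A ω = a then (1 : ℝ) else 0) |
          MeasurableSpace.comap X inferInstance]) =ᵐ[P] fun ω => pr a (X ω))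
    (ε : ℝ) (hε : ε ∈ Set.Ioc (0 : ℝ) (1 / 2))
    (hprε : ∀ a ∈ ({1, -1} : Set ℤ), ∀ x, ε ≤ pr a x)
    (ν : ℤ → 𝒳 → 𝒜 → ℝ)
    (hν : ∀ a, Measurable fun q : 𝒳 × 𝒜 => ν a q.1 q.2)
    (hν01 : ∀ a x α, ν a x α ∈ Set.Icc (0 : ℝ) 1)
    (μ : ℤ → 𝒳 → ℝ) (hμmeas : ∀ a, Measurable (μ a))
    (hμ : ∀ a ∈ ({1, -1} : Set ℤ),
      (P[(fun ω => Rl ω * (if A ω = a then (1 : ℝ) else 0)) |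
          MeasurableSpace.comap X inferInstance])
        =ᵐ[P] fun ω => μ a (X ω) * pr a (X ω))
    -- fix `α`, with `u_α` and `v_α` the conditional signed weights
    (α : 𝒜)
    (u v : 𝒳 → ℝ) (humeas : Measurable u) (hvmeas : Measurable v)
    (hu : (P[(fun ω => |Dadv X A pr ν Rl α ω|
          * (if (if 0 ≤ Dadv X A pr ν Rl α ω then (1 : ℤ) else -1) = 1
              then (1 : ℝ) else 0)) |
        MeasurableSpace.comap X inferInstance]) =ᵐ[P] fun ω => u (X ω))
    (hv : (P[(fun ω => |Dadv X A pr ν Rl α ω|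
          * (if (if 0 ≤ Dadv X A pr ν Rl α ω then (1 : ℤ) else -1) = -1
              then (1 : ℝ) else 0)) |
        MeasurableSpace.comap X inferInstance]) =ᵐ[P] fun ω => v (X ω)) :
    -- `g†_α` minimizes the certified hinge risk over all measurable scores
    (∀ g : 𝒳 → ℝ, Measurable g →
      hingeRisk P X A pr ν Rl α
          (fun x => if v x < u x then 1 else if u x < v x then -1 else 0)
        ≤ hingeRisk P X A pr ν Rl α g) ∧
    -- and the induced rule `d_{g†_α} = sgn(g†_α)` (with `sgn 0 = 1`) is Bayes-optimal
    -- for the certified value `V_R̲`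
    (∀ d' : 𝒳 → ℤ, IsRule d' →
      VR P X A pr Rl d'
        ≤ VR P X A pr Rl (fun x =>
            if 0 ≤ (if v x < u x then (1 : ℝ) else if u x < v x then -1 else 0)
            then 1 else -1)) := by
  have hνα : ∀ a, Measurable fun x => ν a x α := fun a =>
    (hν a).comp (measurable_id.prodMk measurable_const)
  have hD : Integrable (Dadv X A pr ν Rl α) P :=
    (integrable_Gam hX hA hRl hRl01 (hpr 1) hε.1 (hprε 1 (by simp)) (hνα 1)
      fun x => hν01 1 x α).sub
    (integrable_Gam hX hA hRl hRl01 (hpr (-1)) hε.1 (hprε (-1) (by simp)) (hνα (-1))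
      fun x => hν01 (-1) x α)
  have hpos : Integrable (fun ω => |Dadv X A pr ν Rl α ω|
      * (if (if 0 ≤ Dadv X A pr ν Rl α ω then (1 : ℤ) else -1) = 1
          then (1 : ℝ) else 0)) P := by
    refine hD.pos_part.congr (ae_of_all _ fun ω => ?_)
    rcases le_or_gt 0 (Dadv X A pr ν Rl α ω) with h | h
    · simp [h, abs_of_nonneg h]
    · simp [not_le.mpr h, h.le]
  have hneg : Integrable (fun ω => |Dadv X A pr ν Rl α ω|
      * (if (if 0 ≤ Dadv X A pr ν Rl α ω then (1 : ℤ) else -1) = -1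
          then (1 : ℝ) else 0)) P := by
    refine hD.neg_part.congr (ae_of_all _ fun ω => ?_)
    rcases le_or_gt 0 (Dadv X A pr ν Rl α ω) with h | h
    · simp [h]
    · simp [not_le.mpr h, h.le, abs_of_neg h]
  have hreg : P[Dadv X A pr ν Rl α | MeasurableSpace.comap X inferInstance]
      =ᵐ[P] fun ω => u (X ω) - v (X ω) := by
    have hsplit : Dadv X A pr ν Rl α = (fun ω => |Dadv X A pr ν Rl α ω|
        * (if (if 0 ≤ Dadv X A pr ν Rl α ω then (1 : ℤ) else -1) = 1
            then (1 : ℝ) else 0)) - fun ω => |Dadv X A pr ν Rl α ω|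
        * (if (if 0 ≤ Dadv X A pr ν Rl α ω then (1 : ℤ) else -1) = -1
            then (1 : ℝ) else 0) := by
      funext ω
      rcases le_or_gt 0 (Dadv X A pr ν Rl α ω) with h | h
      · simp [h, not_lt.mpr h, abs_of_nonneg h]
      · simp [h, not_le.mpr h, abs_of_neg h]
    have hsub := condExp_sub hpos hneg (MeasurableSpace.comap X inferInstance)
    rw [← hsplit] at hsub
    filter_upwards [hsub, hu, hv] with ω h1 h2 h3
    rw [h1, Pi.sub_apply, h2, h3]
  have hvu : MeasurableSet {x | v x < u x} := measurableSet_lt hvmeas humeas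
  have huv : MeasurableSet {x | u x < v x} := measurableSet_lt humeas hvmeas
  have hg : Measurable fun x => if v x < u x then (1 : ℝ) else if u x < v x then -1 else 0 :=
    Measurable.ite hvu measurable_const (Measurable.ite huv measurable_const measurable_const)
  refine ⟨fun g hgm => ?_, fun d' hd' => ?_⟩
  · refine le_trans ?_ (hingeRisk_clip_le P X A pr ν Rl α g)
    have hclip : Measurable fun x => max (-1) (min 1 (g x)) :=
      measurable_const.max (measurable_const.min hgm)
    have hclip1 : ∀ x, |max (-1) (min 1 (g x))| ≤ 1 := fun x =>
      abs_le.mpr ⟨le_max_left _ _, max_le (by norm_num) (min_le_left _ _)⟩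
    have hg1 : ∀ x, |if v x < u x then (1 : ℝ) else if u x < v x then -1 else 0| ≤ 1 :=
      fun x => by split_ifs <;> simp
    rw [hingeRisk_eq_ofReal_integral hX hD hg hg1,
      hingeRisk_eq_ofReal_integral hX hD hclip hclip1]
    refine ENNReal.ofReal_le_ofReal (sub_le_sub_left ?_ _)
    refine integral_mul_comp_le_of_mul_eq_abs (φ := fun x => u x - v x) hX hD hreg hclip hg
      hclip1 hg1 fun x => ?_
    split_ifs with h1 h2
    · rw [abs_of_pos (sub_pos.mpr h1), mul_one]
    · rw [abs_of_neg (sub_neg.mpr h2), mul_neg_one]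
    · rw [le_antisymm (not_lt.mp h1) (not_lt.mp h2)]; simp
  · have hd : IsRule fun x =>
        if 0 ≤ (if v x < u x then (1 : ℝ) else if u x < v x then -1 else 0)
          then (1 : ℤ) else -1 :=
      ⟨Measurable.ite (measurableSet_le measurable_const hg) measurable_const measurable_const,
        fun x => by dsimp only; split_ifs <;> simp⟩
    have hcast : ∀ {d : 𝒳 → ℤ}, IsRule d →
        (Measurable fun x => (d x : ℝ)) ∧ ∀ x, |(d x : ℝ)| ≤ 1 := fun {d} h =>
      ⟨measurable_from_top.comp h.1, fun x => by rcases h.2 x with h | h <;> simp [h]⟩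
    rw [VR_eq_add_integral_Dadv hX hA hA1 hRl hRl01 hpr hprver hε.1 hprε hνα
        (fun a x => hν01 a x α) hD hd',
      VR_eq_add_integral_Dadv hX hA hA1 hRl hRl01 hpr hprver hε.1 hprε hνα
        (fun a x => hν01 a x α) hD hd]
    refine add_le_add_right (div_le_div_of_nonneg_right ?_ zero_le_two) _
    refine integral_mul_comp_le_of_mul_eq_abs (φ := fun x => u x - v x) hX hD hreg
      (hcast hd').1 (hcast hd).1 (hcast hd').2 (hcast hd).2 fun x => ?_
    rcases lt_trichotomy (u x) (v x) with h | h | h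
    · simp [h, not_lt.mpr h.le, abs_of_neg (sub_neg.mpr h)]
    · simp [h]
    · simp [h, abs_of_pos (sub_pos.mpr h)]
end
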